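/- arXiv:1310.0654 — 3 statements merged into one kernel-verified Lean document; each statement's English description precedes it below -/
import Mathlib

section
/- Let X ⊆ S^{Z^2} be a two-dimensional SFT with the P-property that is either countable or southward deterministic. Then there exists k ∈ N such that the subpattern poset of X contains no chain of length k, i.e., there are no configurations x_1, …, x_k ∈ X with x_1 < x_2 < ⋯ < x_k in the subpattern preorder. -/
/-- Translation of a two-dimensional configuration. -/
def shift2 {S : Type*} (n : ℤ × ℤ) (x : ℤ × ℤ → S) : ℤ × ℤ → S := fun m => x (n + m)

/-- The pattern with domain `D` and content `p` occurs in `x`. -/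
def occurs2 {S : Type*} (D : Finset (ℤ × ℤ)) (p : ℤ × ℤ → S) (x : ℤ × ℤ → S) : Prop :=
  ∃ n : ℤ × ℤ, ∀ m ∈ D, x (n + m) = p m

/-- A two-dimensional subshift of finite type: the configurations in which no pattern from a
fixed finite set of forbidden finite patterns occurs. -/
def IsSFT2 {S : Type*} (X : Set (ℤ × ℤ → S)) : Prop :=
  ∃ F : Set (Finset (ℤ × ℤ) × (ℤ × ℤ → S)), F.Finite ∧
    X = {x | ∀ P ∈ F, ¬ occurs2 P.1 P.2 x}

/-- `x ≤ y` in the subpattern preorder: every finite pattern occurring in `x` occurs in `y`. -/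
def patLE2 {S : Type*} (x y : ℤ × ℤ → S) : Prop :=
  ∀ (D : Finset (ℤ × ℤ)) (n : ℤ × ℤ), ∃ n' : ℤ × ℤ, ∀ m ∈ D, y (n' + m) = x (n + m)

/-- `x < y` in the subpattern preorder. -/
def patLT2 {S : Type*} (x y : ℤ × ℤ → S) : Prop := patLE2 x y ∧ ¬ patLE2 y x

/-- The `i`-th row of a two-dimensional configuration. -/
def row {S : Type*} (x : ℤ × ℤ → S) (i : ℤ) : ℤ → S := fun j => x (j, i)

/-- The (horizontal) projective subdynamics of `X`: its set of rows at height `0`. -/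
def PS2 {S : Type*} (X : Set (ℤ × ℤ → S)) : Set (ℤ → S) := (fun x => row x 0) '' X

/-- The shift map on bi-infinite configurations. -/
def shift1 {S : Type*} (x : ℤ → S) : ℤ → S := fun m => x (m + 1)

/-- The word `u` occurs in `x` at position `n`. -/
def occursAtW {S : Type*} (u : List S) (x : ℤ → S) (n : ℤ) : Prop :=
  ∀ i : Fin u.length, x (n + ((i : ℕ) : ℤ)) = u.get i

/-- The word `u` occurs in the configuration `x`. -/
def occursW {S : Type*} (u : List S) (x : ℤ → S) : Prop := ∃ n : ℤ, occursAtW u x n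

/-- The word `u` occurs in some configuration of `X`. -/
def occursWIn {S : Type*} (X : Set (ℤ → S)) (u : List S) : Prop := ∃ x ∈ X, occursW u x

/-- A one-dimensional subshift of finite type: the configurations avoiding a finite set of
forbidden words. -/
def IsSFT1 {S : Type*} (X : Set (ℤ → S)) : Prop :=
  ∃ F : Set (List S), F.Finite ∧ X = {x | ∀ u ∈ F, ¬ occursW u x}

/-- `X` is southward deterministic: two configurations of `X` agreeing on the upper half-plane
`{(a,b) : b ≥ 1}` are equal. -/
def SouthDet {S : Type*} (X : Set (ℤ × ℤ → S)) : Prop :=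
  ∀ x ∈ X, ∀ y ∈ X, (∀ a b : ℤ, 1 ≤ b → x (a, b) = y (a, b)) → x = y

/-- The P-property: some subshift conjugate to `X` (via a bijective block map, i.e. a
shift-commuting homeomorphism) has its projective subdynamics contained in a countable
one-dimensional SFT. All alphabets carry the discrete topology. -/
def PProperty {S : Type*} (X : Set (ℤ × ℤ → S)) : Prop :=
  ∃ (T : Type) (_ : Fintype T) (X' : Set (ℤ × ℤ → T))
    (f : (ℤ × ℤ → S) → (ℤ × ℤ → T)) (g : (ℤ × ℤ → T) → (ℤ × ℤ → S)),
    (letI : TopologicalSpace S := ⊥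
     letI : TopologicalSpace T := ⊥
     Continuous f ∧ Continuous g) ∧
    (∀ (n : ℤ × ℤ) x, f (shift2 n x) = shift2 n (f x)) ∧
    (∀ (n : ℤ × ℤ) x, g (shift2 n x) = shift2 n (g x)) ∧
    (∀ x ∈ X, f x ∈ X') ∧ (∀ y ∈ X', g y ∈ X) ∧
    (∀ x ∈ X, g (f x) = x) ∧ (∀ y ∈ X', f (g y) = y) ∧
    ∃ Y : Set (ℤ → T), IsSFT1 Y ∧ Y.Countable ∧ PS2 X' ⊆ Y

/-- `y` is `ℓ`-rigid with respect to `e`: if three windows of length `ℓ` of `y` agree up to the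
action `e`, then the two loops between them commute. -/
def LoopRigid {R : Type*} (e : ℤ → R → R) (ℓ : ℕ) (y : ℤ → R) : Prop :=
  ∀ a b c α β γ : ℤ, a < b → b < c →
    (∀ i : ℤ, 0 ≤ i → i < ℓ → e α (y (a + i)) = e β (y (b + i))) →
    (∀ i : ℤ, 0 ≤ i → i < ℓ → e β (y (b + i)) = e γ (y (c + i))) →
    (∀ i : ℤ, 0 ≤ i → i < c - b + ℓ → e α (y (a + i)) = e β (y (b + i))) ∧
    (∀ i : ℤ, -(b - a) ≤ i → i < ℓ → e β (y (b + i)) = e γ (y (c + i)))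

/-- `Y` contains every sequence whose windows of length `ℓ + 1` all occur, up to the action `e`,
in one fixed element of `Y`. -/
def StepClosed {R : Type*} (e : ℤ → R → R) (ℓ : ℕ) (Y : Set (ℤ → R)) : Prop :=
  ∀ y ∈ Y, ∀ z : ℤ → R,
    (∀ t : ℤ, ∃ n α : ℤ, ∀ i : ℤ, 0 ≤ i → i ≤ ℓ → z (t + i) = e α (y (n + i))) → z ∈ Y

/-- The trivial action of `ℤ`. -/
def trivAct {R : Type*} (_ : ℤ) (x : R) : R := x

section Sequences

variable {R : Type*}

theorem StepClosed.reflect {e : ℤ → R → R} {ℓ : ℕ} {Y : Set (ℤ → R)} (h : StepClosed e ℓ Y) :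
    StepClosed e ℓ {y | (fun t => y (-t)) ∈ Y} := by
  intro y hy z hz
  refine h _ hy _ fun t => ?_
  obtain ⟨n, α, hn⟩ := hz (-t - ℓ)
  refine ⟨-n - ℓ, α, fun i hi hi' => ?_⟩
  have := hn (ℓ - i) (by omega) (by omega)
  convert this using 2
  · ring
  · congr 1; ring

theorem LoopRigid.reflect {e : ℤ → R → R} {ℓ : ℕ} {y : ℤ → R} (h : LoopRigid e ℓ y) :
    LoopRigid e ℓ (fun t => y (-t)) := by
  intro a b c α β γ hab hbc h1 h2
  have key := h (-c - ℓ + 1) (-b - ℓ + 1) (-a - ℓ + 1) γ β α (by omega) (by omega)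
    (fun i hi hi' => by
      have := (h2 (ℓ - 1 - i) (by omega) (by omega)).symm
      convert this using 3 <;> ring)
    (fun i hi hi' => by
      have := (h1 (ℓ - 1 - i) (by omega) (by omega)).symm
      convert this using 3 <;> ring)
  refine ⟨fun i hi hi' => ?_, fun i hi hi' => ?_⟩
  · have := (key.2 (ℓ - 1 - i) (by omega) (by omega)).symm
    convert this using 3 <;> ring
  · have := (key.1 (ℓ - 1 - i) (by omega) (by omega)).symm
    convert this using 3 <;> ring

/-- A sequence that follows `y` along positions `π` and shifts `θ` with matching windows has all
its windows of length `ℓ + 1` in `y`. -/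
theorem shadow_window {e : ℤ → R → R} {ℓ : ℕ} {y : ℤ → R} {π θ : ℤ → ℤ}
    (h : ∀ t i : ℤ, 0 ≤ i → i < ℓ →
      e (θ t) (y (π t + 1 + i)) = e (θ (t + 1)) (y (π (t + 1) + i))) (t : ℤ) (i : ℕ) (hi : i ≤ ℓ) :
    e (θ (t + i)) (y (π (t + i))) = e (θ t) (y (π t + i)) := by
  induction i generalizing t with
  | zero => simp
  | succ i ih =>
    have h1 := ih (t + 1) (by omega)
    have h2 := h t i (by omega) (by omega)
    push_cast
    rw [show t + ((i : ℤ) + 1) = t + 1 + i by ring, h1, ← h2]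
    congr 2; ring

theorem int_succ_ediv_emod (t L : ℤ) (hL : 0 < L) :
    ((t + 1) / L = t / L ∧ (t + 1) % L = t % L + 1 ∧ t % L + 1 < L) ∨
    ((t + 1) / L = t / L + 1 ∧ (t + 1) % L = 0 ∧ t % L = L - 1) := by
  have h1 := Int.emod_add_mul_ediv t L
  have h2 := Int.emod_nonneg t hL.ne'
  have h3 := Int.emod_lt_of_pos t hL
  by_cases h : t % L + 1 < L
  · left
    have hq : (t + 1) / L = t / L := by
      rw [Int.ediv_eq_iff_of_pos hL]; constructor <;> nlinarith
    refine ⟨hq, ?_, h⟩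
    rw [Int.emod_def, hq]; linarith
  · right
    have hq : (t + 1) / L = t / L + 1 := by
      rw [Int.ediv_eq_iff_of_pos hL]; constructor <;> nlinarith
    refine ⟨hq, ?_, by omega⟩
    rw [Int.emod_def, hq]; nlinarith

/-- In a countable step-closed set, two loops based at the same window start in the same way. -/
theorem StepClosed.loops_agree {e : ℤ → R → R} (hadd : ∀ a b x, e (a + b) x = e a (e b x))
    {ℓ : ℕ} {Y : Set (ℤ → R)} (hY : StepClosed e ℓ Y) (hc : Y.Countable) {y : ℤ → R} (hy : y ∈ Y)
    {a b c α β γ : ℤ} (hab : a < b) (hbc : b < c)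
    (h1 : ∀ i : ℤ, 0 ≤ i → i < ℓ → e α (y (a + i)) = e β (y (b + i)))
    (h2 : ∀ i : ℤ, 0 ≤ i → i < ℓ → e β (y (b + i)) = e γ (y (c + i)))
    (i : ℤ) (hi : 0 ≤ i) (hi' : i < c - b + ℓ) : e α (y (a + i)) = e β (y (b + i)) := by
  classical
  by_contra hne
  obtain ⟨L, hLdef⟩ : ∃ L, L = c - a := ⟨_, rfl⟩
  have hL : 0 < L := by omega
  let π : (ℤ → Bool) → ℤ → ℤ := fun s t =>
    if s (t / L) then a + t % L else
      if t % L < c - b then b + t % L else a + (t % L - (c - b))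
  let θ : (ℤ → Bool) → ℤ → ℤ := fun s t =>
    (t / L) * (α - γ) + if s (t / L) then α else
      if t % L < c - b then β else β - γ + α
  have hstep : ∀ s t i, 0 ≤ i → i < (ℓ : ℤ) →
      e (θ s t) (y (π s t + 1 + i)) = e (θ s (t + 1)) (y (π s (t + 1) + i)) := by
    intro s t i hi hi'
    have ha := h1 i hi hi'
    have hb := h2 i hi hi'
    have hm := Int.emod_nonneg t hL.ne'
    simp only [π, θ]
    rcases int_succ_ediv_emod t L hL with ⟨hq, hr, hlt⟩ | ⟨hq, hr, hlt⟩
    · rw [hq, hr]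
      by_cases hs : s (t / L) = true
      · simp only [hs, if_true]; congr 2; ring
      · simp only [hs]
        by_cases h3 : t % L + 1 < c - b
        · have h4 : t % L < c - b := by omega
          simp only [h3, h4, if_true, Bool.false_eq_true, if_false]
          congr 2; ring
        · by_cases h4 : t % L < c - b
          · simp only [h3, h4, if_true, Bool.false_eq_true, if_false]
            rw [show b + t % L + 1 + i = c + i by omega,
              show a + (t % L + 1 - (c - b)) + i = a + i by omega,
              show t / L * (α - γ) + β = (t / L * (α - γ) + β - γ) + γ by ring,
              show t / L * (α - γ) + (β - γ + α) = (t / L * (α - γ) + β - γ) + α by ring,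
              hadd _ γ, hadd _ α, ha, hb]
          · simp only [h3, h4, Bool.false_eq_true, if_false]
            congr 2; ring
    · rw [hq, hr]
      have hpos : (0 : ℤ) < c - b := by omega
      have target : e ((t / L + 1) * (α - γ) + if s (t / L + 1) = true then α else β)
          (y ((if s (t / L + 1) = true then a else b) + i)) =
          e ((t / L + 1) * (α - γ)) (e α (y (a + i))) := by
        rw [hadd]; split_ifs
        · rfl
        · rw [ha]
      simp only [if_pos hpos, add_zero]
      rw [target]
      by_cases hs : s (t / L) = true
      · simp only [hs, if_true]
        rw [ha, hb, ← hadd, show a + t % L + 1 + i = c + i by omega]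
        congr 1
        ring
      · simp only [hs]
        have h4 : ¬ t % L < c - b := by omega
        simp only [h4, Bool.false_eq_true, if_false]
        rw [ha, ← hadd, show a + (t % L - (c - b)) + 1 + i = b + i by omega]
        congr 1
        ring
  let Z : (ℤ → Bool) → ℤ → R := fun s t => e (θ s t) (y (π s t))
  have hwin : ∀ s t (i : ℤ), 0 ≤ i → i ≤ ℓ → Z s (t + i) = e (θ s t) (y (π s t + i)) := by
    intro s t i hi hi'
    lift i to ℕ using hi
    exact shadow_window (hstep s) t i (by omega)
  have hZ : ∀ s, Z s ∈ Y := fun s => hY y hy _ fun t => ⟨π s t, θ s t, fun i hi hi' =>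
    hwin s t i hi hi'⟩
  have hinj : Function.Injective Z := by
    intro s s' hss
    funext k
    set j := min i (c - b - 1) with hj
    have hval : ∀ s, Z s (k * L + i) = e (k * (α - γ)) (if s k = true then e α (y (a + i))
        else e β (y (b + i))) := by
      intro s
      have hdiv : (k * L + j) / L = k := by
        rw [Int.ediv_eq_iff_of_pos hL]; constructor <;> nlinarith [min_le_right i (c - b - 1),
          (by omega : 0 ≤ j), (by omega : j < L)]
      have hmod : (k * L + j) % L = j := by
        rw [Int.emod_def, hdiv]; ring
      have := hwin s (k * L + j) (i - j) (by omega) (by omega)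
      rw [show k * L + j + (i - j) = k * L + i by ring] at this
      rw [this]
      simp only [θ, π, hdiv, hmod, if_pos (show j < c - b by omega)]
      rw [hadd]
      split_ifs
      · congr 3; ring
      · congr 3; ring
    have h3 := congrFun hss (k * L + i)
    rw [hval, hval] at h3
    have hcancel : ∀ u v, e (k * (α - γ)) (e α u) = e (k * (α - γ)) (e β v) →
        e α u = e β v := by
      intro u v h
      have := congrArg (e (-(k * (α - γ)))) h
      rw [← hadd, ← hadd, ← hadd, ← hadd] at this
      simpa using this
    cases hs : s k <;> cases hs' : s' k <;> simp [hs, hs'] at h3 ⊢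
    · exact hne (hcancel _ _ h3.symm)
    · exact hne (hcancel _ _ h3)
  have hu : Uncountable (ℤ → Bool) := by
    rw [← Cardinal.aleph0_lt_mk_iff]
    simpa using Cardinal.cantor Cardinal.aleph0
  have : (Set.range Z).Countable := hc.mono (Set.range_subset_iff.2 hZ)
  have hcount : Countable (ℤ → Bool) := by
    have := this.to_subtype
    exact (Set.rangeFactorization_injective.2 hinj).countable
  exact hu.not_countable hcount

/-- Elements of a countable step-closed set are rigid. -/
theorem StepClosed.loopRigid {e : ℤ → R → R} (hadd : ∀ a b x, e (a + b) x = e a (e b x))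
    {ℓ : ℕ} {Y : Set (ℤ → R)} (hY : StepClosed e ℓ Y) (hc : Y.Countable) {y : ℤ → R} (hy : y ∈ Y) :
    LoopRigid e ℓ y := by
  intro a b c α β γ hab hbc h1 h2
  refine ⟨fun i hi hi' => hY.loops_agree hadd hc hy hab hbc h1 h2 i hi hi', fun i hi hi' => ?_⟩
  have hc' : {y : ℤ → R | (fun t => y (-t)) ∈ Y}.Countable :=
    hc.preimage (f := fun (y : ℤ → R) t => y (-t)) fun y y' h => by
      funext t; simpa using congrFun h (-t)
  have hy' : (fun t => y (-t)) ∈ {y : ℤ → R | (fun t => y (-t)) ∈ Y} := by simpa using hy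
  have := hY.reflect.loops_agree hadd hc' hy' (a := -c - ℓ + 1) (b := -b - ℓ + 1)
    (c := -a - ℓ + 1) (α := γ) (β := β) (γ := α) (by omega) (by omega)
    (fun i hi hi' => by
      have := (h2 (ℓ - 1 - i) (by omega) (by omega)).symm
      convert this using 3 <;> ring)
    (fun i hi hi' => by
      have := (h1 (ℓ - 1 - i) (by omega) (by omega)).symm
      convert this using 3 <;> ring)
    (ℓ - 1 - i) (by omega) (by omega)
  convert this.symm using 3 <;> ring

/-- Along a function of finite range, eventually only recurring values are taken. -/
theorem eventually_frequently_eq {W : Type*} (w : ℤ → W) (hw : (Set.range w).Finite) :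
    ∃ N : ℤ, ∀ t, N ≤ t → ∀ M, ∃ t', M ≤ t' ∧ w t' = w t := by
  have : ∀ᶠ t in Filter.atTop, ∀ v ∈ Set.range w, (∃ᶠ t' in Filter.atTop, w t' = v) ∨ w t ≠ v := by
    rw [Filter.eventually_all_finite hw]
    intro v _
    by_cases h : ∃ᶠ t' in Filter.atTop, w t' = v
    · simp [h]
    · rw [Filter.not_frequently] at h
      filter_upwards [h] with t ht using Or.inr ht
  obtain ⟨N, hN⟩ := Filter.eventually_atTop.1 this
  refine ⟨N, fun t ht M => ?_⟩
  rcases hN t ht (w t) ⟨t, rfl⟩ with h | h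
  · obtain ⟨t', h1, h2⟩ := Filter.frequently_atTop.1 h M
    exact ⟨t', h1, h2⟩
  · exact absurd rfl h

/-- Eventually every window recurs. -/
theorem windows_recur {y : ℤ → R} (hy : (Set.range y).Finite) (ℓ : ℕ) :
    ∃ N : ℤ, ∀ t, N ≤ t → ∀ M, ∃ t', M ≤ t' ∧ ∀ i : ℤ, 0 ≤ i → i ≤ ℓ → y (t' + i) = y (t + i) := by
  obtain ⟨N, hN⟩ := eventually_frequently_eq
    (fun t => (fun i : Fin (ℓ + 1) => y (t + (i : ℕ)))) (by
      refine (Set.Finite.pi' (fun _ : Fin (ℓ + 1) => hy)).subset ?_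
      rintro _ ⟨t, rfl⟩ i
      exact ⟨_, rfl⟩)
  refine ⟨N, fun t ht M => ?_⟩
  obtain ⟨t', h1, h2⟩ := hN t ht M
  refine ⟨t', h1, fun i hi hi' => ?_⟩
  lift i to ℕ using hi
  exact congrFun h2 ⟨i, by omega⟩

theorem LoopRigid.eq_right {e : ℤ → R → R} (h0 : ∀ x, e 0 x = x) {ℓ : ℕ} {y : ℤ → R}
    (h : LoopRigid e ℓ y)
    (hy : (Set.range y).Finite) :
    ∃ N : ℤ, ∀ z : ℤ → R, (∀ i, N ≤ i → i ≤ N + ℓ → z i = y i) →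
      (∀ t : ℤ, ∃ n α : ℤ, ∀ i : ℤ, 0 ≤ i → i ≤ ℓ → z (t + i) = e α (y (n + i))) →
      ∀ i, N ≤ i → z i = y i := by
  obtain ⟨N, hN⟩ := windows_recur hy ℓ
  refine ⟨N, fun z hz hw => ?_⟩
  suffices H : ∀ k : ℕ, ∀ i, N ≤ i → i ≤ N + ℓ + k → z i = y i from
    fun i hi => H (i - N).toNat i hi (by omega)
  intro k
  induction k with
  | zero => simpa using hz
  | succ k ih =>
    intro i hi hi'
    push_cast at hi'
    by_cases hle : i ≤ N + ℓ + k
    · exact ih i hi hle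
    obtain rfl : i = N + ℓ + k + 1 := by omega
    obtain ⟨n, α, hn⟩ := hw (N + k + 1)
    obtain ⟨s, hs, hs'⟩ := hN (N + k + 1) (by omega) (n + 1)
    obtain ⟨s2, hs2, hs2'⟩ := hN (N + k + 1) (by omega) (s + 1)
    have hq : ∀ i : ℤ, 0 ≤ i → i < ℓ → e α (y (n + i)) = y (N + k + 1 + i) := by
      intro i hi hi'
      rw [← hn i hi hi'.le]
      exact ih _ (by omega) (by omega)
    have := (h n s s2 α 0 0 (by omega) (by omega)
      (fun i hi hi' => by rw [h0, hq i hi hi', hs' i hi hi'.le])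
      (fun i hi hi' => by rw [h0, h0, hs2' i hi hi'.le, hs' i hi hi'.le])).1 ℓ
      (by omega) (by omega)
    rw [h0] at this
    have e1 := hn ℓ (by omega) le_rfl
    have e2 := hs' ℓ (by omega) le_rfl
    rw [show N + (ℓ : ℤ) + k + 1 = N + k + 1 + ℓ by ring, e1, this, e2]

/-- A rigid sequence of finite range is isolated among the sequences with the same windows. -/
theorem LoopRigid.isolated {e : ℤ → R → R} (h0 : ∀ x, e 0 x = x) {ℓ : ℕ} {y : ℤ → R}
    (h : LoopRigid e ℓ y)
    (hy : (Set.range y).Finite) :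
    ∃ N : ℕ, ∀ z : ℤ → R, (∀ i : ℤ, |i| ≤ N → z i = y i) →
      (∀ t : ℤ, ∃ n α : ℤ, ∀ i : ℤ, 0 ≤ i → i ≤ ℓ → z (t + i) = e α (y (n + i))) → z = y := by
  obtain ⟨N, hN⟩ := h.eq_right h0 hy
  obtain ⟨N', hN'⟩ := h.reflect.eq_right h0 (hy.subset (by rintro _ ⟨t, rfl⟩; exact ⟨_, rfl⟩))
  refine ⟨N.natAbs + N'.natAbs + ℓ, fun z hz hw => ?_⟩
  have H1 := hN z (fun i hi hi' => hz i (by rw [abs_le]; omega)) hw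
  have H2 := hN' (fun t => z (-t)) (fun i hi hi' => hz (-i) (by rw [abs_le]; omega)) (by
    intro t
    obtain ⟨n, α, hn⟩ := hw (-t - ℓ)
    refine ⟨-n - ℓ, α, fun i hi hi' => ?_⟩
    have := hn (ℓ - i) (by omega) (by omega)
    convert this using 2
    · ring
    · congr 1; ring)
  funext i
  by_cases h1 : N ≤ i
  · exact H1 i h1
  by_cases h2 : N' ≤ -i
  · simpa using H2 (-i) h2
  exact hz i (by rw [abs_le]; omega)

theorem LoopRigid.eventually_periodic_right [Fintype R] {ℓ : ℕ} {y : ℤ → R}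
    (h : LoopRigid trivAct ℓ y) :
    ∃ N : ℤ, ∀ m, N ≤ m → y (m + (Fintype.card (Fin ℓ → R)).factorial) = y m := by
  obtain ⟨N, hN⟩ := windows_recur (Set.toFinite (Set.range y)) ℓ
  set q := Fintype.card (Fin ℓ → R) with hq
  obtain ⟨s, t, hst, hw⟩ := Fintype.exists_ne_map_eq_of_card_lt
    (fun (s : Fin (q + 1)) (i : Fin ℓ) => y (N + (s : ℕ) + (i : ℕ))) (by simp [hq])
  wlog hlt : s < t generalizing s t
  · exact this t s hst.symm hw.symm (lt_of_le_of_ne (not_lt.1 hlt) hst.symm)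
  have hlt' : (s : ℕ) < (t : ℕ) := hlt
  have ht := t.2
  have hper : ∀ m, N + (s : ℕ) ≤ m → y (m + ((t : ℕ) - (s : ℕ) : ℕ)) = y m := by
    intro m hm
    obtain ⟨c, hc, hc'⟩ := hN (N + (t : ℕ)) (by omega) (m + 1 + (t : ℕ) - (s : ℕ))
    have := (h (N + (s : ℕ)) (N + (t : ℕ)) c 0 0 0 (by omega) (by omega)
      (fun i hi hi' => by
        lift i to ℕ using hi
        exact congrFun hw ⟨i, by omega⟩)
      (fun i hi hi' => (hc' i hi hi'.le).symm)).1 (m - (N + (s : ℕ))) (by omega) (by omega)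
    simp only [trivAct] at this
    convert this.symm using 2
    · omega
    · omega
  have hmul : ∀ k : ℕ, ∀ m, N + (s : ℕ) ≤ m →
      y (m + (((t : ℕ) - (s : ℕ) : ℕ) * k : ℕ)) = y m := by
    intro k
    induction k with
    | zero => simp
    | succ k ih =>
      intro m hm
      rw [← ih m hm, ← hper _ (show N + (s : ℕ) ≤ m + (((t : ℕ) - (s : ℕ) : ℕ) * k : ℕ) by omega)]
      congr 1
      push_cast
      ring
  obtain ⟨k, hk⟩ := Nat.dvd_factorial (show 0 < (t : ℕ) - (s : ℕ) by omega)
    (show (t : ℕ) - (s : ℕ) ≤ q by omega)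
  exact ⟨N + (s : ℕ), fun m hm => by rw [hk]; exact hmul k m hm⟩

/-- Rigid sequences over a finite alphabet are eventually periodic in both directions, with a
period that depends only on the alphabet and the window length. -/
theorem LoopRigid.eventually_periodic [Fintype R] {ℓ : ℕ} {y : ℤ → R}
    (h : LoopRigid trivAct ℓ y) :
    ∃ N : ℕ, ∀ m, (N : ℤ) ≤ m ∨ m + (Fintype.card (Fin ℓ → R)).factorial ≤ -N →
      y (m + (Fintype.card (Fin ℓ → R)).factorial) = y m := by
  obtain ⟨N, hN⟩ := h.eventually_periodic_right
  obtain ⟨N', hN'⟩ := h.reflect.eventually_periodic_right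
  refine ⟨N.natAbs + N'.natAbs, fun m hm => ?_⟩
  rcases hm with hm | hm
  · exact hN m (by omega)
  · have := hN' (-(m + (Fintype.card (Fin ℓ → R)).factorial)) (by omega)
    convert this.symm using 2 <;> ring

end Sequences

/-- The horizontal shift action on rows. -/
def rowAct {T : Type*} (α : ℤ) (y : ℤ → T) : ℤ → T := fun j => y (j + α)

theorem rowAct_add {T : Type*} (a b : ℤ) (y : ℤ → T) :
    rowAct (a + b) y = rowAct a (rowAct b y) := by
  funext j; simp [rowAct, add_assoc]

/-- `f` is a block map of radius `h`. -/
def IsLocal {S T : Type*} (h : ℕ) (f : (ℤ × ℤ → S) → (ℤ × ℤ → T)) : Prop :=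
  ∀ x y n, (∀ m : ℤ × ℤ, |m.1 - n.1| ≤ h → |m.2 - n.2| ≤ h → x m = y m) → f x n = f y n

theorem IsLocal.mono {S T : Type*} {h k : ℕ} (hk : h ≤ k) {f : (ℤ × ℤ → S) → (ℤ × ℤ → T)}
    (hf : IsLocal h f) : IsLocal k f := fun x y n hxy =>
  hf x y n fun m h1 h2 => hxy m (h1.trans (by exact_mod_cast hk)) (h2.trans (by exact_mod_cast hk))

theorem exists_finset_determining {S U : Type*} [TopologicalSpace S] [DiscreteTopology S]
    [TopologicalSpace U] [DiscreteTopology U] {X : Set (ℤ × ℤ → S)} (hX : IsCompact X)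
    (P : Set (ℤ × ℤ)) (φ : (ℤ × ℤ → S) → U) (hφ : Continuous φ)
    (h : ∀ x ∈ X, ∀ y ∈ X, (∀ m ∈ P, x m = y m) → φ x = φ y) :
    ∃ F : Finset (ℤ × ℤ), ↑F ⊆ P ∧
      ∀ x ∈ X, ∀ y ∈ X, (∀ m ∈ F, x m = y m) → φ x = φ y := by
  classical
  have hK : IsCompact ((X ×ˢ X) ∩ {q | φ q.1 ≠ φ q.2}) := by
    refine (hX.prod hX).inter_right ?_
    have : Continuous fun q : (ℤ × ℤ → S) × (ℤ × ℤ → S) => (φ q.1, φ q.2) := by fun_prop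
    exact (isClosed_discrete {u : U × U | u.1 ≠ u.2}).preimage this
  obtain ⟨t, ht⟩ := hK.elim_finite_subcover
    (fun m : P => {q : (ℤ × ℤ → S) × (ℤ × ℤ → S) | q.1 m ≠ q.2 m}) (fun m => by
      have : Continuous fun q : (ℤ × ℤ → S) × (ℤ × ℤ → S) => (q.1 (m : ℤ × ℤ), q.2 (m : ℤ × ℤ)) := by
        fun_prop
      exact (isOpen_discrete {u : S × S | u.1 ≠ u.2}).preimage this) (by
      rintro ⟨x, y⟩ ⟨⟨hx, hy⟩, hne⟩
      by_contra hcon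
      simp only [Set.mem_iUnion, Set.mem_ofPred_eq, not_exists, not_not] at hcon
      exact hne (h x hx y hy fun m hm => hcon ⟨m, hm⟩))
  refine ⟨t.image Subtype.val, ?_, fun x hx y hy hxy => ?_⟩
  · intro m hm
    simp only [Finset.coe_image, Set.mem_image] at hm
    obtain ⟨m', _, rfl⟩ := hm
    exact m'.2
  · by_contra hne
    have := ht (show (x, y) ∈ _ from ⟨⟨hx, hy⟩, hne⟩)
    simp only [Set.mem_iUnion, Set.mem_ofPred_eq] at this
    obtain ⟨m, hm, hm'⟩ := this
    exact hm' (hxy m (Finset.mem_image_of_mem _ hm))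

theorem exists_box (F : Finset (ℤ × ℤ)) : ∃ h : ℕ, ∀ m ∈ F, |m.1| ≤ h ∧ |m.2| ≤ h := by
  refine ⟨F.sup fun m => m.1.natAbs + m.2.natAbs, fun m hm => ?_⟩
  have := Finset.le_sup (f := fun m : ℤ × ℤ => m.1.natAbs + m.2.natAbs) hm
  rw [abs_le, abs_le]
  omega

theorem exists_isLocal {S T : Type*} [Finite S] [TopologicalSpace S] [DiscreteTopology S]
    [TopologicalSpace T] [DiscreteTopology T] (f : (ℤ × ℤ → S) → (ℤ × ℤ → T)) (hf : Continuous f)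
    (hs : ∀ (n : ℤ × ℤ) x, f (shift2 n x) = shift2 n (f x)) : ∃ h, IsLocal h f := by
  obtain ⟨F, -, hF⟩ := exists_finset_determining (X := (Set.univ : Set (ℤ × ℤ → S)))
    isCompact_univ Set.univ (fun x => f x 0) (by fun_prop) (by
      intro x _ y _ h
      rw [show x = y from funext fun m => h m trivial])
  obtain ⟨h, hh⟩ := exists_box F
  refine ⟨h, fun x y n hxy => ?_⟩
  have := hF (shift2 n x) trivial (shift2 n y) trivial fun m hm =>
    hxy (n + m) (by simpa using (hh m hm).1) (by simpa using (hh m hm).2)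
  simpa [hs, shift2] using this

theorem IsLocal.patLE2 {S T : Type*} {h : ℕ} {f : (ℤ × ℤ → S) → (ℤ × ℤ → T)} (hf : IsLocal h f)
    (hs : ∀ (n : ℤ × ℤ) x, f (shift2 n x) = shift2 n (f x)) {x y : ℤ × ℤ → S} (hxy : patLE2 x y) :
    patLE2 (f x) (f y) := by
  classical
  intro D n
  obtain ⟨n', hn'⟩ := hxy (D.biUnion fun m =>
    Finset.Icc (m.1 - h) (m.1 + h) ×ˢ Finset.Icc (m.2 - h) (m.2 + h)) n
  refine ⟨n', fun m hm => ?_⟩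
  have := hf (shift2 n' y) (shift2 n x) m fun q h1 h2 => hn' q (by
    rw [abs_le] at h1 h2
    simp only [Finset.mem_biUnion, Finset.mem_product, Finset.mem_Icc]
    exact ⟨m, hm, by omega, by omega⟩)
  simpa [hs, shift2] using this

theorem IsSFT2.shift_mem {S : Type*} {X : Set (ℤ × ℤ → S)} (hX : IsSFT2 X) {x : ℤ × ℤ → S}
    (hx : x ∈ X) (n : ℤ × ℤ) : shift2 n x ∈ X := by
  obtain ⟨F, -, rfl⟩ := hX
  rintro P hP ⟨k, hk⟩
  exact hx P hP ⟨n + k, fun m hm => by rw [← hk m hm, shift2, add_assoc]⟩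

theorem IsSFT2.isClosed {S : Type*} [TopologicalSpace S] [DiscreteTopology S]
    {X : Set (ℤ × ℤ → S)} (hX : IsSFT2 X) : IsClosed X := by
  obtain ⟨F, -, rfl⟩ := hX
  simp only [Set.ofPred_forall]
  refine isClosed_iInter fun P => isClosed_iInter fun _ => ?_
  rw [← isOpen_compl_iff]
  have : {x : ℤ × ℤ → S | ¬ occurs2 P.1 P.2 x}ᶜ =
      ⋃ n : ℤ × ℤ, ⋂ m ∈ P.1, {x | x (n + m) = P.2 m} := by
    ext x; simp [occurs2]
  rw [this]
  refine isOpen_iUnion fun n => isOpen_biInter_finset fun m _ => ?_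
  exact (isOpen_discrete ({P.2 m} : Set S)).preimage
    (by fun_prop : Continuous fun x : ℤ × ℤ → S => x (n + m))

/-- A conjugate image of a two-dimensional SFT is closed under gluing along tall strips. -/
theorem IsSFT2.stepClosed_conj {S T : Type*} {X : Set (ℤ × ℤ → S)} (hX : IsSFT2 X)
    {f : (ℤ × ℤ → S) → (ℤ × ℤ → T)} {g : (ℤ × ℤ → T) → (ℤ × ℤ → S)} {h : ℕ}
    (hg : IsLocal h g) (hfg : IsLocal h (f ∘ g))
    (hgs : ∀ (n : ℤ × ℤ) x, g (shift2 n x) = shift2 n (g x))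
    (hfgs : ∀ (n : ℤ × ℤ) x, (f ∘ g) (shift2 n x) = shift2 n ((f ∘ g) x))
    (hgf : ∀ x ∈ X, g (f x) = x) :
    ∃ ℓ, StepClosed rowAct ℓ (row '' (f '' X)) := by
  obtain ⟨F, hF, rfl⟩ := hX
  obtain ⟨k, hk⟩ := exists_box (hF.toFinset.sup Prod.fst)
  have hk' : ∀ P ∈ F, ∀ m ∈ P.1, |m.2| ≤ (k : ℤ) := fun P hP m hm =>
    (hk m (Finset.mem_of_subset (Finset.le_sup (f := Prod.fst) (hF.mem_toFinset.2 hP)) hm)).2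
  refine ⟨2 * (h + k), ?_⟩
  rintro _ ⟨_, ⟨x, hx, rfl⟩, rfl⟩ z hz
  let zz : ℤ × ℤ → T := fun m => z m.2 m.1
  have key : ∀ n : ℤ × ℤ, ∃ v : ℤ × ℤ, ∀ m : ℤ × ℤ, |m.2 - n.2| ≤ h + k →
      zz m = shift2 v (f x) m := by
    intro n
    obtain ⟨s, α, hs⟩ := hz (n.2 - (h + k))
    refine ⟨(α, s - (n.2 - (h + k))), fun m hm => ?_⟩
    rw [abs_le] at hm
    have := congrFun (hs (m.2 - (n.2 - (h + k))) (by omega) (by push_cast; omega)) m.1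
    simp only [rowAct, row] at this
    simp only [zz, shift2]
    convert this using 2
    · ring
    · ext <;> simp <;> ring
  refine ⟨zz, ⟨g zz, ?_, ?_⟩, rfl⟩
  · rintro P hP ⟨n, hn⟩
    obtain ⟨v, hv⟩ := key n
    refine hx P hP ⟨v + n, fun m hm => ?_⟩
    rw [← hn m hm]
    have hm2 := hk' P hP m hm
    have := hg zz (shift2 v (f x)) (n + m) fun q _ hq => hv q (by
      simp only [Prod.snd_add] at hq
      rw [abs_le] at hq hm2 ⊢
      omega)
    rw [this, hgs, hgf x hx, shift2, add_assoc]
  · funext n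
    obtain ⟨v, hv⟩ := key n
    have h0 : |n.2 - n.2| ≤ (h : ℤ) + k := by simp; positivity
    rw [hv n h0]
    have := hfg zz (shift2 v (f x)) n fun q _ hq => hv q (by omega)
    simp only [Function.comp_apply] at this hfgs
    rw [this, hfgs, hgf x hx]

/-- A sequence in which windows determine, up to the action, everything below them is rigid. -/
theorem loopRigid_of_determined {R : Type*} {e : ℤ → R → R}
    (hadd : ∀ a b x, e (a + b) x = e a (e b x)) {r : ℕ} {y : ℤ → R}
    (h : ∀ a b α β : ℤ, (∀ i : ℤ, 0 ≤ i → i < r → e α (y (a + i)) = e β (y (b + i))) →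
      e α (y (a - 1)) = e β (y (b - 1))) : LoopRigid e r y := by
  have down : ∀ a b α β : ℤ, (∀ i : ℤ, 0 ≤ i → i < r → e α (y (a + i)) = e β (y (b + i))) →
      ∀ i : ℤ, i < r → e α (y (a + i)) = e β (y (b + i)) := by
    intro a b α β hab
    have : ∀ k : ℕ, ∀ i : ℤ, -k ≤ i → i < r → e α (y (a + i)) = e β (y (b + i)) := by
      intro k
      induction k with
      | zero => simpa using hab
      | succ k ih =>
        intro i hi hi'
        by_cases hik : -(k : ℤ) ≤ i
        · exact ih i hik hi'
        have := h (a - k) (b - k) α β fun j hj hj' => by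
          have := ih (j - k) (by omega) (by omega)
          convert this using 3 <;> ring
        convert this using 3 <;> push_cast at hi <;> omega
    exact fun i hi => this i.natAbs i (by omega) hi
  intro a b c α β γ hab hbc h1 h2
  have d1 := down a b α β h1
  have d2 := down b c β γ h2
  refine ⟨fun i hi hi' => ?_, fun i _ hi' => d2 i hi'⟩
  by_cases hir : i < r
  · exact d1 i hir
  have s1 := d1 (i - (c - b)) (by omega)
  have s2 := d2 (i - (c - b)) (by omega)
  have s3 := d2 (i - (c - b) - (b - a)) (by omega)
  have s4 := d1 (i - (c - b) - (b - a)) (by omega)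
  rw [show b + (i - (c - b) - (b - a)) = a + (i - (c - b)) by ring,
    show c + (i - (c - b) - (b - a)) = a + i by ring] at s3
  rw [show c + (i - (c - b)) = b + i by ring] at s2
  rw [show α = (α - γ) + γ by ring, hadd, ← s3, ← hadd, show α - γ + β = (β - γ) + α by ring, hadd,
    s1, s2, ← hadd]
  congr 1; ring

/-- The southward deterministic case: configurations are rigid. -/
theorem SouthDet.loopRigid {T : Type*} [TopologicalSpace T] [DiscreteTopology T]
    {X : Set (ℤ × ℤ → T)} (hd : SouthDet X) (hX : IsCompact X)
    (hs : ∀ x ∈ X, ∀ n, shift2 n x ∈ X) : ∃ r : ℕ, ∀ x ∈ X, LoopRigid rowAct r (row x) := by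
  obtain ⟨F, hF, hF'⟩ := exists_finset_determining hX {m : ℤ × ℤ | 1 ≤ m.2} (fun x => x 0)
    (continuous_apply 0) (by
      intro x hx y hy h
      rw [hd x hx y hy fun a b hb => h (a, b) hb])
  obtain ⟨r, hr⟩ := exists_box F
  refine ⟨r, fun x hx => loopRigid_of_determined rowAct_add fun a b α β h => ?_⟩
  funext j
  have := hF' _ (hs x hx (j + α, a - 1)) _ (hs x hx (j + β, b - 1)) fun m hm => by
    have h1 : 1 ≤ m.2 := hF hm
    have h2 := (abs_le.1 (hr m hm).2).2
    have := congrFun (h (m.2 - 1) (by omega) (by omega)) (j + m.1)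
    simp only [rowAct, row] at this
    simp only [shift2]
    convert this using 2
    · ext <;> simp <;> ring
    · ext <;> simp <;> ring
  simpa [shift2, rowAct, row] using this

theorem SouthDet.conj {S T : Type*} {X : Set (ℤ × ℤ → S)} (hd : SouthDet X)
    (hs : ∀ x ∈ X, ∀ n, shift2 n x ∈ X)
    {f : (ℤ × ℤ → S) → (ℤ × ℤ → T)} {g : (ℤ × ℤ → T) → (ℤ × ℤ → S)} {h : ℕ}
    (hg : IsLocal h g) (hgf : ∀ x ∈ X, g (f x) = x) : SouthDet (f '' X) := by
  rintro _ ⟨x, hx, rfl⟩ _ ⟨y, hy, rfl⟩ hxy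
  have : shift2 (0, h) x = shift2 (0, h) y := hd _ (hs x hx _) _ (hs y hy _) fun a b hb => by
    have := hg (f x) (f y) (a, h + b) fun m _ hm => hxy m.1 m.2 (by
      rw [abs_le] at hm; simp only at hm; omega)
    simpa [shift2, hgf x hx, hgf y hy] using this
  have hxy : x = y := by
    funext m
    have := congrFun this (m - (0, (h : ℤ)))
    simpa [shift2] using this
  rw [hxy]

theorem IsSFT1.stepClosed {T : Type*} {Y : Set (ℤ → T)} (hY : IsSFT1 Y) :
    ∃ ℓ, StepClosed trivAct ℓ Y := by
  obtain ⟨F, hF, rfl⟩ := hY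
  refine ⟨hF.toFinset.sup List.length, fun y hy z hz u hu ⟨t, ht⟩ => ?_⟩
  obtain ⟨n, _, hn⟩ := hz t
  refine hy u hu ⟨n, fun i => ?_⟩
  rw [← ht i]
  refine (hn i (by positivity) ?_).symm
  have := Finset.le_sup (f := List.length) (hF.mem_toFinset.2 hu)
  exact_mod_cast (i.2.le.trans this)

section Words

variable {T : Type*}

/-- The words of length `ℓ + 1` occurring in `y`. -/
def words (ℓ : ℕ) (y : ℤ → T) : Set (Fin (ℓ + 1) → T) :=
  {w | ∃ n : ℤ, ∀ i : Fin (ℓ + 1), y (n + (i : ℕ)) = w i}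

theorem words_rowAct (ℓ : ℕ) (y : ℤ → T) (α : ℤ) : words ℓ (rowAct α y) = words ℓ y := by
  ext w
  constructor
  · rintro ⟨n, hn⟩
    exact ⟨n + α, fun i => by rw [← hn i, rowAct]; congr 1; ring⟩
  · rintro ⟨n, hn⟩
    exact ⟨n - α, fun i => by rw [← hn i, rowAct]; congr 1; ring⟩

/-- Configurations close to a rigid one have at least as many words, and equality holds only for
the rigid one itself. -/
theorem LoopRigid.words_lt [Finite T] {ℓ : ℕ} {y : ℤ → T} (h : LoopRigid trivAct ℓ y) :
    ∃ N : ℕ, ∀ z : ℤ → T, (∀ i : ℤ, |i| ≤ N → z i = y i) →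
      (words ℓ y).ncard ≤ (words ℓ z).ncard ∧
        ((words ℓ z).ncard ≤ (words ℓ y).ncard → z = y) := by
  obtain ⟨N, hN⟩ := h.isolated (fun _ => rfl) (Set.toFinite _)
  choose! pos hpos using fun (w : Fin (ℓ + 1) → T) (hw : w ∈ words ℓ y) => hw
  obtain ⟨M, hM⟩ : ∃ M : ℕ, ∀ w ∈ words ℓ y, |pos w| ≤ M := by
    have hfin : (words ℓ y).Finite := Set.toFinite _
    refine ⟨hfin.toFinset.sup fun w => (pos w).natAbs, fun w hw => ?_⟩
    have := Finset.le_sup (f := fun w => (pos w).natAbs) (hfin.mem_toFinset.2 hw)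
    rw [abs_le]; omega
  refine ⟨max N (M + ℓ), fun z hz => ?_⟩
  have hsub : words ℓ y ⊆ words ℓ z := fun w hw => ⟨pos w, fun i => by
    rw [← hpos w hw i]
    have := hM w hw
    refine hz _ ?_
    rw [abs_le] at this ⊢
    have := i.2
    push_cast
    omega⟩
  refine ⟨Set.ncard_le_ncard hsub, fun hle => hN z (fun i hi => hz i ?_) fun t => ?_⟩
  · push_cast; exact le_max_of_le_left hi
  · have heq := Set.eq_of_subset_of_ncard_le hsub hle
    have : (fun i : Fin (ℓ + 1) => z (t + (i : ℕ))) ∈ words ℓ y := by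
      rw [heq]; exact ⟨t, fun _ => rfl⟩
    obtain ⟨n, hn⟩ := this
    refine ⟨n, 0, fun i hi hi' => ?_⟩
    lift i to ℕ using hi
    exact (hn ⟨i, by omega⟩).symm

/-- The number of words in the strip of height `r` whose lowest row is `b`, counted row by row. -/
noncomputable def stripCount (ℓ r : ℕ) (x : ℤ × ℤ → T) (b : ℤ) : ℕ :=
  ∑ i ∈ Finset.range r, (words ℓ (row x (b + i))).ncard

/-- The maximal word count of a strip of height `r`. -/
noncomputable def maxStripCount (ℓ r : ℕ) (x : ℤ × ℤ → T) : ℕ := ⨆ b, stripCount ℓ r x b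

theorem stripCount_le [Fintype T] (ℓ r : ℕ) (x : ℤ × ℤ → T) (b : ℤ) :
    stripCount ℓ r x b ≤ r * Nat.card (Fin (ℓ + 1) → T) := by
  refine (Finset.sum_le_card_nsmul _ _ (Nat.card (Fin (ℓ + 1) → T)) fun i _ => ?_).trans (by simp)
  exact Set.ncard_le_card _

theorem stripCount_le_max [Fintype T] (ℓ r : ℕ) (x : ℤ × ℤ → T) (b : ℤ) :
    stripCount ℓ r x b ≤ maxStripCount ℓ r x :=
  le_ciSup (f := stripCount ℓ r x) ⟨_, Set.forall_mem_range.2 (stripCount_le ℓ r x)⟩ b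

theorem exists_stripCount_eq_max [Fintype T] (ℓ r : ℕ) (x : ℤ × ℤ → T) :
    ∃ b, stripCount ℓ r x b = maxStripCount ℓ r x :=
  Nat.sSup_mem (Set.range_nonempty (stripCount ℓ r x))
    ⟨_, Set.forall_mem_range.2 (stripCount_le ℓ r x)⟩

theorem maxStripCount_le [Fintype T] (ℓ r : ℕ) (x : ℤ × ℤ → T) :
    maxStripCount ℓ r x ≤ r * Nat.card (Fin (ℓ + 1) → T) :=
  ciSup_le (stripCount_le ℓ r x)

end Words

section Periods

variable {T : Type*}

/-- The central box of radius `N` of `x` occurs in `x'` at `n`. -/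
def BoxOcc (x x' : ℤ × ℤ → T) (N : ℕ) (n : ℤ × ℤ) : Prop :=
  ∀ m : ℤ × ℤ, |m.1| ≤ N → |m.2| ≤ N → x' (n + m) = x m

theorem BoxOcc.mono {x x' : ℤ × ℤ → T} {N M : ℕ} (hNM : N ≤ M) {n : ℤ × ℤ}
    (h : BoxOcc x x' M n) : BoxOcc x x' N n := fun m h1 h2 =>
  h m (h1.trans (by exact_mod_cast hNM)) (h2.trans (by exact_mod_cast hNM))

theorem patLE2.exists_boxOcc {x x' : ℤ × ℤ → T} (h : patLE2 x x') (N : ℕ) :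
    ∃ n, BoxOcc x x' N n := by
  obtain ⟨n, hn⟩ := h (Finset.Icc (-N : ℤ) N ×ˢ Finset.Icc (-N : ℤ) N) 0
  refine ⟨n, fun m h1 h2 => ?_⟩
  rw [abs_le] at h1 h2
  simpa using hn m (by simp only [Finset.mem_product, Finset.mem_Icc]; exact ⟨h1, h2⟩)

theorem patLE2_of_forall_eq {x x' : ℤ × ℤ → T} {n : ℤ × ℤ} (h : ∀ m, x' (n + m) = x m) :
    patLE2 x' x := fun D k => ⟨k - n, fun m _ => by rw [← h]; congr 1; abel⟩

/-- All rows of `x` have period `p`. -/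
def HPer (p : ℕ) (x : ℤ × ℤ → T) : Prop := ∀ b, Function.Periodic (row x b) (p : ℤ)

/-- `x` has a non-horizontal period. -/
def VPer (x : ℤ × ℤ → T) : Prop :=
  ∃ α β : ℤ, 0 < β ∧ ∀ a b, x (a + α, b + β) = x (a, b)

theorem exists_forall_of_antitone {ι : Type*} (s : Finset ι) {P : ℕ → ι → Prop}
    (hP : ∀ N M i, N ≤ M → P M i → P N i) (h : ∀ N, ∃ i ∈ s, P N i) : ∃ i ∈ s, ∀ N, P N i := by
  by_contra! hcon
  choose! B hB using hcon
  obtain ⟨i, hi, hPi⟩ := h (s.sup B)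
  exact hB i hi (hP _ _ i (Finset.le_sup hi) hPi)

theorem HPer.of_patLE2 {p : ℕ} {x x' : ℤ × ℤ → T} (h : patLE2 x x') (hx' : HPer p x') :
    HPer p x := by
  intro b a
  obtain ⟨n, hn⟩ := h.exists_boxOcc (a.natAbs + b.natAbs + p)
  simp only [row]
  rw [← hn (a + p, b) (by rw [abs_le]; omega) (by rw [abs_le]; omega),
    ← hn (a, b) (by rw [abs_le]; omega) (by rw [abs_le]; omega)]
  change x' (n.1 + (a + p), n.2 + b) = x' (n.1 + a, n.2 + b)
  rw [← add_assoc]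
  exact hx' (n.2 + b) (n.1 + a)

/-- If `x` is a limit of translates of `x'` by vectors of bounded height, and is not itself a
translate, then the rows of `x` are periodic. -/
theorem hPer_of_bounded_height {p : ℕ} {x x' : ℤ × ℤ → T}
    (hper : ∀ b, ∃ M : ℕ, ∀ m, (M : ℤ) ≤ m ∨ m + p ≤ -M → row x' b (m + p) = row x' b m)
    (hne : ¬ patLE2 x' x) (B : ℕ) (hB : ∀ N, ∃ n, |n.2| ≤ (B : ℤ) ∧ BoxOcc x x' N n) :
    HPer p x := by
  intro b a
  by_contra hab
  choose M hM using hper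
  set K := (Finset.Icc (b - B) (b + B)).sup M with hK
  have hnear : ∀ N n, a.natAbs + b.natAbs + p ≤ N → |n.2| ≤ (B : ℤ) → BoxOcc x x' N n →
      |n.1| ≤ K + a.natAbs + p := by
    intro N n hN hn hocc
    by_contra hfar
    have hle : M (n.2 + b) ≤ K := Finset.le_sup (f := M) (by
      rw [abs_le] at hn; rw [Finset.mem_Icc]; omega)
    have h1 := hocc (a + p, b) (by rw [abs_le]; omega) (by rw [abs_le]; omega)
    have h2 := hocc (a, b) (by rw [abs_le]; omega) (by rw [abs_le]; omega)
    have h3 := hM (n.2 + b) (n.1 + a) (by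
      rw [abs_le] at hfar
      omega)
    apply hab
    simp only [row] at h3 ⊢
    rw [← h1, ← h2]
    change x' (n.1 + (a + p), n.2 + b) = x' (n.1 + a, n.2 + b)
    rw [← add_assoc]
    exact h3
  obtain ⟨n, -, hn⟩ := exists_forall_of_antitone
    (Finset.Icc (-(K + a.natAbs + p : ℤ)) (K + a.natAbs + p) ×ˢ Finset.Icc (-B : ℤ) B)
    (P := BoxOcc x x') (fun N M n h1 h2 => h2.mono h1) (by
      intro N
      obtain ⟨n, hn, hocc⟩ := hB (max N (a.natAbs + b.natAbs + p))
      refine ⟨n, ?_, hocc.mono (le_max_left _ _)⟩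
      have := hnear _ n (le_max_right _ _) hn hocc
      rw [abs_le] at this hn
      simp only [Finset.mem_product, Finset.mem_Icc]
      exact ⟨this, hn⟩)
  exact hne (patLE2_of_forall_eq fun m =>
    hn (m.1.natAbs + m.2.natAbs) m (by rw [abs_le]; omega) (by rw [abs_le]; omega))

theorem VPer.hPer_of_lt {p : ℕ} {x x' : ℤ × ℤ → T}
    (hper : ∀ b, ∃ M : ℕ, ∀ m, (M : ℤ) ≤ m ∨ m + p ≤ -M → row x' b (m + p) = row x' b m)
    (h : patLT2 x x') (hv : VPer x') : HPer p x := by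
  obtain ⟨α, β, hβ, hv⟩ := hv
  have hv' : ∀ (k : ℤ) (m : ℤ × ℤ), x' (m + (k * α, k * β)) = x' m := by
    intro k
    induction k using Int.induction_on with
    | zero => intro m; congr 1; ext <;> simp
    | succ k ih =>
      intro m
      rw [← ih m]
      have := hv (m.1 + k * α) (m.2 + k * β)
      convert this using 2 <;>
        ext <;> simp <;> ring
    | pred k ih =>
      intro m
      rw [← ih m]
      have := hv (m.1 + (-k - 1) * α) (m.2 + (-k - 1) * β)
      convert this.symm using 2 <;>
        ext <;> simp <;> ring
  refine hPer_of_bounded_height hper h.2 β.natAbs fun N => ?_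
  obtain ⟨n, hn⟩ := h.1.exists_boxOcc N
  refine ⟨n + (-(n.2 / β) * α, -(n.2 / β) * β), ?_, fun m h1 h2 => ?_⟩
  · have h1 := Int.emod_nonneg n.2 hβ.ne'
    have h2 := Int.emod_lt_of_pos n.2 hβ
    rw [Int.emod_def] at h1 h2
    simp only [Prod.snd_add]
    rw [abs_le]
    constructor <;> nlinarith [abs_of_pos hβ, Int.natCast_natAbs β]
  · rw [← hn m h1 h2, ← hv' (-(n.2 / β)) (n + m)]
    congr 1; abel

/-- If `x < x'` and the strips of `x` have at least as many words as those of `x'`, then `x` has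
periodic rows or a vertical period. -/
theorem vPer_of_maxStripCount_le [Fintype T] {p ℓ r : ℕ} {x x' : ℤ × ℤ → T}
    (hper : ∀ b, ∃ M : ℕ, ∀ m, (M : ℤ) ≤ m ∨ m + p ≤ -M → row x' b (m + p) = row x' b m)
    (hrow : ∀ b, LoopRigid trivAct ℓ (row x b)) (hx' : LoopRigid rowAct r (row x'))
    (h : patLT2 x x') (hH : ¬ HPer p x) (hD : maxStripCount ℓ r x' ≤ maxStripCount ℓ r x) :
    VPer x := by
  obtain ⟨j, hj⟩ := exists_stripCount_eq_max ℓ r x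
  choose M hM using fun b => (hrow b).words_lt
  set N₀ := (Finset.range r).sup (fun i => M (j + i)) + j.natAbs + r with hN₀
  have hstrip : ∀ n, BoxOcc x x' N₀ n → ∀ i : ℤ, 0 ≤ i → i < r →
      rowAct n.1 (row x' (n.2 + j + i)) = row x (j + i) := by
    intro n hn
    have hpt : ∀ i ∈ Finset.range r, (words ℓ (row x (j + i))).ncard ≤
        (words ℓ (row x' (n.2 + j + i))).ncard ∧
        ((words ℓ (row x' (n.2 + j + i))).ncard ≤ (words ℓ (row x (j + i))).ncard →
          rowAct n.1 (row x' (n.2 + j + i)) = row x (j + i)) := by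
      intro i hi
      rw [← words_rowAct ℓ (row x' (n.2 + j + i)) n.1]
      refine hM (j + i) _ fun t ht => ?_
      have hle := Finset.le_sup (f := fun i : ℕ => M (j + i)) hi
      rw [Finset.mem_range] at hi
      have := hn (t, j + i) (by simp only; omega) (by simp only; rw [abs_le]; omega)
      simp only [rowAct, row]
      rw [← this]
      congr 1; ext <;> simp <;> ring
    have hsum : stripCount ℓ r x' (n.2 + j) ≤ stripCount ℓ r x j :=
      (stripCount_le_max ℓ r x' _).trans (hD.trans hj.ge)
    intro i hi hi'
    lift i to ℕ using hi
    have hi'' : i ∈ Finset.range r := Finset.mem_range.2 (by omega)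
    refine (hpt i hi'').2 (le_of_eq ?_)
    have heq : stripCount ℓ r x j = stripCount ℓ r x' (n.2 + j) :=
      le_antisymm (Finset.sum_le_sum fun i hi => (hpt i hi).1) hsum
    exact ((Finset.sum_eq_sum_iff_of_le fun i hi => (hpt i hi).1).1 heq i hi'').symm
  have hunb : ∀ B : ℕ, ∃ N, ∀ n, BoxOcc x x' N n → (B : ℤ) < |n.2| := by
    by_contra! hcon
    obtain ⟨B, hB⟩ := hcon
    exact hH (hPer_of_bounded_height hper h.2 B fun N => by
      obtain ⟨n, h1, h2⟩ := hB N
      exact ⟨n, h2, h1⟩)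
  have hdir : (∀ N B : ℕ, ∃ n, BoxOcc x x' N n ∧ (B : ℤ) < n.2) ∨
      (∀ N B : ℕ, ∃ n, BoxOcc x x' N n ∧ n.2 < -(B : ℤ)) := by
    by_contra! hcon
    obtain ⟨⟨N₁, B₁, h₁⟩, ⟨N₂, B₂, h₂⟩⟩ := hcon
    obtain ⟨N₃, h₃⟩ := hunb (max B₁ B₂)
    obtain ⟨n, hn⟩ := h.1.exists_boxOcc (max N₃ (max N₁ N₂))
    have a1 := h₁ n (hn.mono (by omega))
    have a2 := h₂ n (hn.mono (by omega))
    have a3 := h₃ n (hn.mono (by omega))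
    rcases lt_abs.1 a3 with a3 | a3 <;> push_cast at a3 <;> omega
  have hloop : ∀ n₁ n₂ n₃ : ℤ × ℤ, BoxOcc x x' N₀ n₁ → BoxOcc x x' N₀ n₂ → BoxOcc x x' N₀ n₃ →
      n₁.2 < n₂.2 → n₂.2 < n₃.2 → _ := fun n₁ n₂ n₃ o₁ o₂ o₃ h12 h23 =>
    hx' (n₁.2 + j) (n₂.2 + j) (n₃.2 + j) n₁.1 n₂.1 n₃.1 (by omega) (by omega)
      (fun i hi hi' => (hstrip n₁ o₁ i hi hi').trans (hstrip n₂ o₂ i hi hi').symm)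
      (fun i hi hi' => (hstrip n₂ o₂ i hi hi').trans (hstrip n₃ o₃ i hi hi').symm)
  rcases hdir with hdir | hdir
  · obtain ⟨n₁, o₁, -⟩ := hdir N₀ 0
    obtain ⟨n₂, o₂, h12⟩ := hdir N₀ n₁.2.natAbs
    refine ⟨n₂.1 - n₁.1, n₂.2 - n₁.2, by omega, fun a b => ?_⟩
    have hp : ∀ i : ℤ, 0 ≤ i → rowAct n₁.1 (row x' (n₁.2 + j + i)) =
        rowAct n₂.1 (row x' (n₂.2 + j + i)) := by
      intro i hi
      obtain ⟨n₃, o₃, h23⟩ := hdir N₀ (n₂.2.natAbs + i.natAbs)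
      exact (hloop n₁ n₂ n₃ o₁ o₂ o₃ (by omega) (by omega)).1 i hi (by omega)
    obtain ⟨n, o, hn⟩ := hdir (a.natAbs + b.natAbs + (n₂.1 - n₁.1).natAbs + (n₂.2 - n₁.2).natAbs)
      (n₁.2.natAbs + j.natAbs + b.natAbs)
    rw [← o (a, b) (by rw [abs_le]; omega) (by rw [abs_le]; omega),
      ← o (a + (n₂.1 - n₁.1), b + (n₂.2 - n₁.2)) (by rw [abs_le]; omega) (by rw [abs_le]; omega)]
    have := congrFun (hp (n.2 + b - n₁.2 - j) (by omega)) (n.1 + a - n₁.1)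
    simp only [rowAct, row] at this
    convert this.symm using 2 <;> ext <;> simp <;> ring
  · obtain ⟨n₃, o₃, -⟩ := hdir N₀ 0
    obtain ⟨n₂, o₂, h23⟩ := hdir N₀ n₃.2.natAbs
    refine ⟨n₃.1 - n₂.1, n₃.2 - n₂.2, by omega, fun a b => ?_⟩
    have hp : ∀ i : ℤ, i < r → rowAct n₂.1 (row x' (n₂.2 + j + i)) =
        rowAct n₃.1 (row x' (n₃.2 + j + i)) := by
      intro i hi
      obtain ⟨n₁, o₁, h12⟩ := hdir N₀ (n₂.2.natAbs + i.natAbs)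
      exact (hloop n₁ n₂ n₃ o₁ o₂ o₃ (by omega) (by omega)).2 i (by omega) hi
    obtain ⟨n, o, hn⟩ := hdir (a.natAbs + b.natAbs + (n₃.1 - n₂.1).natAbs + (n₃.2 - n₂.2).natAbs)
      (n₂.2.natAbs + j.natAbs + b.natAbs)
    rw [← o (a, b) (by rw [abs_le]; omega) (by rw [abs_le]; omega),
      ← o (a + (n₃.1 - n₂.1), b + (n₃.2 - n₂.2)) (by rw [abs_le]; omega) (by rw [abs_le]; omega)]
    have := congrFun (hp (n.2 + b - n₂.2 - j) (by omega)) (n.1 + a - n₂.1)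
    simp only [rowAct, row] at this
    convert this.symm using 2 <;> ext <;> simp <;> ring

/-- The patterns of width `p` and height `r + 1` occurring in `x`. -/
def blocks (p r : ℕ) (x : ℤ × ℤ → T) : Set (Fin p × Fin (r + 1) → T) :=
  {w | ∃ n : ℤ × ℤ, ∀ q, x (n.1 + (q.1 : ℕ), n.2 + (q.2 : ℕ)) = w q}

theorem patLE2.blocks_subset {p r : ℕ} {x x' : ℤ × ℤ → T} (h : patLE2 x x') :
    blocks p r x ⊆ blocks p r x' := by
  classical
  rintro w ⟨n, hn⟩
  obtain ⟨n', hn'⟩ := h (Finset.univ.image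
    fun q : Fin p × Fin (r + 1) => (((q.1 : ℕ) : ℤ), ((q.2 : ℕ) : ℤ))) n
  exact ⟨n', fun q => (hn' _ (Finset.mem_image_of_mem _ (Finset.mem_univ q))).trans (hn q)⟩

theorem periodic_ext {p : ℕ} (hp : 0 < p) {y z : ℤ → T} (hy : Function.Periodic y (p : ℤ))
    (hz : Function.Periodic z (p : ℤ)) (h : ∀ i : ℕ, i < p → y i = z i) : y = z := by
  funext a
  have hmod : ∀ {u : ℤ → T}, Function.Periodic u (p : ℤ) → u (a % p) = u a := fun hu => by
    rw [Int.emod_def, mul_comm]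
    exact hu.sub_int_mul_eq _
  rw [← hmod hy, ← hmod hz]
  have h1 := Int.emod_nonneg a (show (p : ℤ) ≠ 0 by omega)
  have h2 := Int.emod_lt_of_pos a (show (0 : ℤ) < p by omega)
  lift a % (p : ℤ) to ℕ using h1 with k
  exact h k (by omega)

theorem Function.Periodic.rowAct {p : ℤ} {y : ℤ → T} (hy : Function.Periodic y p) (α : ℤ) :
    Function.Periodic (rowAct α y) p := fun j => by
  simp only [_root_.rowAct]
  rw [add_right_comm, hy]

theorem HPer.ncard_blocks_lt [Finite T] {p r : ℕ} (hp : 0 < p) {x x' : ℤ × ℤ → T}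
    (hx' : HPer p x') (h : patLT2 x x') (hl : LoopRigid rowAct r (row x)) :
    (blocks p r x).ncard < (blocks p r x').ncard := by
  have hx := HPer.of_patLE2 h.1 hx'
  by_contra! hle
  have heq := Set.eq_of_subset_of_ncard_le (h.1.blocks_subset (p := p) (r := r)) hle
  have hfin : (Set.range (row x)).Finite := by
    refine Set.Finite.of_finite_image (f := fun y (i : Fin p) => y ((i : ℕ) : ℤ))
      (Set.toFinite _) ?_
    rintro _ ⟨b, rfl⟩ _ ⟨b', rfl⟩ hbb
    exact periodic_ext hp (hx b) (hx b') fun i hi => congrFun hbb ⟨i, hi⟩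
  obtain ⟨N, hN⟩ := hl.isolated (fun y => by funext j; simp [rowAct]) hfin
  obtain ⟨n, hn⟩ := h.1.exists_boxOcc (N + p)
  have := hN (fun t => rowAct n.1 (row x' (n.2 + t))) (fun t ht =>
      periodic_ext hp ((hx' _).rowAct _) (hx t) fun i hi => by
        have := hn (i, t) (by rw [abs_le]; push_cast; omega) (by push_cast; omega)
        simp only [rowAct, row]
        rw [← this]
        congr 1; ext <;> simp [add_comm]) (by
    intro t
    have hmem : (fun q : Fin p × Fin (r + 1) =>
        x' (n.1 + (q.1 : ℕ), n.2 + t + (q.2 : ℕ))) ∈ blocks p r x := by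
      rw [heq]; exact ⟨(n.1, n.2 + t), fun _ => rfl⟩
    obtain ⟨k, hk⟩ := hmem
    refine ⟨k.2, k.1, fun i hi hi' => ?_⟩
    lift i to ℕ using hi
    refine periodic_ext hp ((hx' _).rowAct _) ((hx _).rowAct _) fun a ha => ?_
    have := hk (⟨a, ha⟩, ⟨i, by omega⟩)
    simp only [rowAct, row]
    simp only at this
    convert this.symm using 2 <;> ext <;> simp <;> ring)
  refine h.2 (patLE2_of_forall_eq (n := n) fun m => ?_)
  have := congrFun (congrFun this m.2) m.1
  simp only [rowAct, row] at this
  rw [← this]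
  congr 1; ext <;> simp [add_comm]

end Periods

/-- Chains of rigid configurations with rigid rows have bounded length. -/
theorem exists_chain_bound {T : Type*} [Fintype T] {X : Set (ℤ × ℤ → T)} {ℓ r : ℕ}
    (hrow : ∀ x ∈ X, ∀ b, LoopRigid trivAct ℓ (row x b))
    (hcol : ∀ x ∈ X, LoopRigid rowAct r (row x)) :
    ∃ k : ℕ, ∀ x : Fin k → ℤ × ℤ → T, (∀ i, x i ∈ X) →
      ¬ ∀ i j : Fin k, i < j → patLT2 (x i) (x j) := by
  classical
  set p := (Fintype.card (Fin ℓ → T)).factorial with hp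
  have hp0 : 0 < p := Nat.factorial_pos _
  have hper : ∀ x ∈ X, ∀ b, ∃ M : ℕ, ∀ m, (M : ℤ) ≤ m ∨ m + p ≤ -M →
      row x b (m + p) = row x b m := fun x hx b => (hrow x hx b).eventually_periodic
  set E := Nat.card (Fin p × Fin (r + 1) → T) with hE
  set D := r * Nat.card (Fin (ℓ + 1) → T) with hD
  let μ : (ℤ × ℤ → T) → ℕ := fun x =>
    if HPer p x then (blocks p r x).ncard else
      if VPer x then E + 1 else E + 2 + maxStripCount ℓ r x
  have hblock : ∀ x : ℤ × ℤ → T, (blocks p r x).ncard ≤ E := fun x => Set.ncard_le_card _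
  have hμ : ∀ x, μ x < E + D + 3 := by
    intro x
    have h1 := hblock x
    have h2 := maxStripCount_le ℓ r x
    simp only [μ]
    split_ifs <;> omega
  have hmono : ∀ x ∈ X, ∀ x' ∈ X, patLT2 x x' → μ x < μ x' := by
    intro x hx x' hx' hlt
    have h1 := hblock x
    simp only [μ]
    by_cases hH' : HPer p x'
    · rw [if_pos hH', if_pos (HPer.of_patLE2 hlt.1 hH')]
      exact hH'.ncard_blocks_lt hp0 hlt (hcol x hx)
    rw [if_neg hH']
    by_cases hH : HPer p x
    · rw [if_pos hH]
      split_ifs <;> omega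
    have hV' : ¬ VPer x' := fun hv => hH (hv.hPer_of_lt (hper x' hx') hlt)
    rw [if_neg hH, if_neg hV']
    by_cases hV : VPer x
    · rw [if_pos hV]; omega
    rw [if_neg hV]
    by_contra! hle
    exact hV (vPer_of_maxStripCount_le (hper x' hx') (hrow x hx) (hcol x' hx') hlt hH (by omega))
  refine ⟨E + D + 4, fun x hx hch => ?_⟩
  have hinj : Function.Injective fun i => (⟨μ (x i), hμ (x i)⟩ : Fin (E + D + 3)) := by
    intro i j hij
    have hij : μ (x i) = μ (x j) := congrArg Fin.val hij
    rcases lt_trichotomy i j with h | h | h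
    · exact absurd hij (hmono _ (hx i) _ (hx j) (hch i j h)).ne
    · exact h
    · exact absurd hij (hmono _ (hx j) _ (hx i) (hch j i h)).ne'
  have := Fintype.card_le_of_injective _ hinj
  simp at this

/-- A two-dimensional SFT with the P-property which is countable or
southward deterministic has no chains of some finite length `k` in its subpattern poset. -/
theorem bounded_chains_of_P_property {S : Type} [Fintype S] (X : Set (ℤ × ℤ → S))
    (hX : IsSFT2 X) (hP : PProperty X) (h : X.Countable ∨ SouthDet X) :
    ∃ k : ℕ, ∀ x : Fin k → ℤ × ℤ → S, (∀ i, x i ∈ X) →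
      ¬ ∀ i j : Fin k, i < j → patLT2 (x i) (x j) := by
  obtain ⟨T, _, X', f, g, hcont, hfs, hgs, hfX, hgX, hgf, hfg, Y, hY, hYc, hPS⟩ := hP
  let : TopologicalSpace S := ⊥
  let : TopologicalSpace T := ⊥
  have : DiscreteTopology S := ⟨rfl⟩
  have : DiscreteTopology T := ⟨rfl⟩
  obtain ⟨hf, hg⟩ := hcont
  have hfgs : ∀ (n : ℤ × ℤ) x, (f ∘ g) (shift2 n x) = shift2 n ((f ∘ g) x) := fun n x => by
    simp only [Function.comp_apply, hgs, hfs]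
  obtain ⟨h₁, lf⟩ := exists_isLocal f hf hfs
  obtain ⟨h₂, lg⟩ := exists_isLocal g hg hgs
  obtain ⟨h₃, lfg⟩ := exists_isLocal (f ∘ g) (hf.comp hg) hfgs
  have hshift : ∀ x ∈ f '' X, ∀ n, shift2 n x ∈ f '' X := by
    rintro _ ⟨x, hx, rfl⟩ n
    exact ⟨shift2 n x, hX.shift_mem hx n, hfs n x⟩
  obtain ⟨ℓ, hℓ⟩ := hY.stepClosed
  have hrow : ∀ x ∈ f '' X, ∀ b, LoopRigid trivAct ℓ (row x b) := by
    intro x hx b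
    refine hℓ.loopRigid (fun _ _ _ => rfl) hYc (hPS ⟨shift2 (0, b) x, ?_, ?_⟩)
    · obtain ⟨y, hy, hy'⟩ := hshift x hx (0, b)
      rw [← hy']
      exact hfX y hy
    · funext j; simp [row, shift2]
  obtain ⟨r, hr⟩ : ∃ r : ℕ, ∀ x ∈ f '' X, LoopRigid rowAct r (row x) := by
    rcases h with hc | hd
    · obtain ⟨r, hr⟩ := hX.stepClosed_conj (lg.mono (le_max_left h₂ h₃))
        (lfg.mono (le_max_right h₂ h₃)) hgs hfgs hgf
      exact ⟨r, fun x hx => hr.loopRigid rowAct_add ((hc.image f).image row) ⟨x, hx, rfl⟩⟩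
    · exact (hd.conj (fun x hx n => hX.shift_mem hx n) lg hgf).loopRigid
        (hX.isClosed.isCompact.image hf) hshift
  obtain ⟨k, hk⟩ := exists_chain_bound hrow hr
  refine ⟨k, fun x hx hch => hk (fun i => f (x i)) (fun i => ⟨x i, hx i, rfl⟩) fun i j hij => ?_⟩
  refine ⟨lf.patLE2 hfs (hch i j hij).1, fun hle => (hch i j hij).2 ?_⟩
  have := lg.patLE2 hgs hle
  rwa [hgf _ (hx i), hgf _ (hx j)] at this
end

section
/- Let X ⊆ S^{Z^2} be a countable two-dimensional SFT whose subpattern poset contains an infinite strictly descending chain x_0 > x_1 > x_2 > ⋯. Then for every direction d ∈ Z^2, the d-projective subdynamics PS_d(X) has Cantor–Bendixson rank at least ω. -/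
/-- The set of non-isolated points of `A` (the derived set of `A` in the subspace topology). -/
def cbDerivedSet {X : Type*} [TopologicalSpace X] (A : Set X) : Set X :=
  {x | x ∈ A ∧ x ∈ closure (A \ {x})}

/-- Transfinite Cantor–Bendixson derivatives of the subspace `A`. -/
noncomputable def cbD {X : Type*} [TopologicalSpace X] (A : Set X) (o : Ordinal.{0}) : Set X :=
  @Ordinal.limitRecOn (fun _ => Set X) o A (fun _ ih => cbDerivedSet ih)
    (fun o _ ih => ⋂ p : {o' : Ordinal.{0} // o' < o}, ih p.1 p.2)

/-- The Cantor–Bendixson rank of `A`: the least ordinal where the derivatives stabilize. -/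
noncomputable def cbRank {X : Type*} [TopologicalSpace X] (A : Set X) : Ordinal.{0} :=
  sInf {o : Ordinal.{0} | cbD A o = cbD A (o + 1)}

/-- `A` is ranked if its derivative of order `cbRank A` is empty. -/
def Ranked {X : Type*} [TopologicalSpace X] (A : Set X) : Prop :=
  cbD A (cbRank A) = ∅

/-- Counterclockwise rotation by 90 degrees. -/
def rot90 (v : ℤ × ℤ) : ℤ × ℤ := (-v.2, v.1)

/-- The action of an element of `SL₂(ℤ)` on integer vectors. -/
def sl2Vec (A : Matrix.SpecialLinearGroup (Fin 2) ℤ) (v : ℤ × ℤ) : ℤ × ℤ :=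
  ((A : Matrix (Fin 2) (Fin 2) ℤ) 0 0 * v.1 + (A : Matrix (Fin 2) (Fin 2) ℤ) 0 1 * v.2,
   (A : Matrix (Fin 2) (Fin 2) ℤ) 1 0 * v.1 + (A : Matrix (Fin 2) (Fin 2) ℤ) 1 1 * v.2)

/-- The action of `SL₂(ℤ)` on configurations: `A(x)_n = x_{A⁻¹ n}`. -/
def confAct {S : Type*} (A : Matrix.SpecialLinearGroup (Fin 2) ℤ) (x : ℤ × ℤ → S) :
    ℤ × ℤ → S := fun n => x (sl2Vec A⁻¹ n)

/-- `X` is deterministic in the direction `d`: the image of `X` under the element of `SL₂(ℤ)`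
taking the 90°-counterclockwise rotation of `d` to `(1,0)` is southward deterministic. -/
def DetInDir {S : Type*} (d : ℤ × ℤ) (X : Set (ℤ × ℤ → S)) : Prop :=
  ∃ A : Matrix.SpecialLinearGroup (Fin 2) ℤ,
    sl2Vec A (rot90 d) = (1, 0) ∧ SouthDet ((confAct A) '' X)

/-- `X` is deterministic in some direction. -/
def DetSomeDir {S : Type*} (X : Set (ℤ × ℤ → S)) : Prop :=
  ∃ d : ℤ × ℤ, IsCoprime d.1 d.2 ∧ DetInDir d X

/-! ### Finite patterns and the product topology -/

section FinitePatterns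

variable {ι S : Type*} [TopologicalSpace S]

theorem isOpen_setOf_forall_finset_eq [DiscreteTopology S] (D : Finset ι) (y : ι → S) :
    IsOpen {z : ι → S | ∀ m ∈ D, z m = y m} := by
  have : {z : ι → S | ∀ m ∈ D, z m = y m} = ⋂ m ∈ D, (fun z : ι → S => z m) ⁻¹' {y m} := by
    ext z; simp
  rw [this]
  exact isOpen_biInter_finset fun m _ => (isOpen_discrete _).preimage (continuous_apply m)

theorem IsOpen.exists_finset_forall_eq_mem {U : Set (ι → S)} (hU : IsOpen U) {y : ι → S}
    (hy : y ∈ U) : ∃ D : Finset ι, ∀ z : ι → S, (∀ m ∈ D, z m = y m) → z ∈ U := by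
  obtain ⟨D, u, hu, hsub⟩ := isOpen_pi_iff.1 hU y hy
  refine ⟨D, fun z hz => hsub fun m hm => ?_⟩
  rw [hz m hm]
  exact (hu m hm).2

theorem mem_closure_iff_forall_finset [DiscreteTopology S] {A : Set (ι → S)} {y : ι → S} :
    y ∈ closure A ↔ ∀ D : Finset ι, ∃ z ∈ A, ∀ m ∈ D, z m = y m := by
  rw [mem_closure_iff]
  constructor
  · intro h D
    obtain ⟨z, hz, hzA⟩ := h _ (isOpen_setOf_forall_finset_eq D y) fun _ _ => rfl
    exact ⟨z, hzA, hz⟩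
  · intro h U hU hy
    obtain ⟨D, hD⟩ := hU.exists_finset_forall_eq_mem hy
    obtain ⟨z, hzA, hz⟩ := h D
    exact ⟨z, hD z hz, hzA⟩

end FinitePatterns

/-- A nonempty subset of a countable closed subset of a compact Hausdorff space has an isolated
point. -/
theorem exists_isolated_of_subset_countable_isClosed {E : Type*} [TopologicalSpace E]
    [CompactSpace E] [T2Space E] {C V : Set E} (hC : IsClosed C) (hcount : C.Countable)
    (hVC : V ⊆ C) (hV : V.Nonempty) : ∃ z ∈ V, ∃ U : Set E, IsOpen U ∧ z ∈ U ∧ U ∩ V ⊆ {z} := by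
  have hsub : closure V ⊆ C := closure_minimal hVC hC
  have : CompactSpace (closure V) := isCompact_iff_compactSpace.1 isClosed_closure.isCompact
  have : Countable (closure V) := (hcount.mono hsub).to_subtype
  have : Nonempty (closure V) := hV.closure.to_subtype
  obtain ⟨z, hz⟩ := nonempty_interior_of_iUnion_of_closed
    (f := fun z : closure V => ({z} : Set (closure V))) (fun _ => isClosed_singleton)
    (by ext z; simp)
  obtain ⟨y, hy⟩ := hz
  have hyz : y = z := Set.mem_singleton_iff.1 (interior_subset hy)
  subst hyz
  obtain ⟨U, hU, hUeq⟩ := isOpen_induced_iff.1 (isOpen_interior (s := ({y} : Set (closure V))))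
  have hyU : (y : E) ∈ U := by
    have : y ∈ Subtype.val ⁻¹' U := by rw [hUeq]; exact hy
    exact this
  have hUV : ∀ v ∈ U, v ∈ closure V → v = y := by
    intro v hvU hvV
    have : (⟨v, hvV⟩ : closure V) ∈ Subtype.val ⁻¹' U := hvU
    rw [hUeq] at this
    exact congrArg Subtype.val (Set.mem_singleton_iff.1 (interior_subset this))
  obtain ⟨v, hvU, hvV⟩ := mem_closure_iff.1 y.2 U hU hyU
  have hvy := hUV v hvU (subset_closure hvV)
  exact ⟨y, hvy ▸ hvV, U, hU, hyU, fun w hw => hUV w hw.1 (subset_closure hw.2)⟩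

/-! ### Cantor–Bendixson derivatives -/

section CantorBendixson

variable {E : Type*} [TopologicalSpace E]

theorem cbD_zero (A : Set E) : cbD A 0 = A := by
  simp [cbD]

theorem cbD_add_one (A : Set E) (o : Ordinal.{0}) : cbD A (o + 1) = cbDerivedSet (cbD A o) := by
  simp [cbD]

theorem cbD_limit (A : Set E) {o : Ordinal.{0}} (ho : Order.IsSuccLimit o) :
    cbD A o = ⋂ p : {o' : Ordinal.{0} // o' < o}, cbD A p.1 := by
  unfold cbD
  rw [Ordinal.limitRecOn_limit _ _ _ _ ho]

theorem cbDerivedSet_subset (A : Set E) : cbDerivedSet A ⊆ A := fun _ h => h.1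

theorem cbD_antitone (A : Set E) : Antitone (cbD A) := by
  intro a b
  induction b using Ordinal.limitRecOn with
  | zero =>
    intro h
    rw [nonpos_iff_eq_zero.1 h]
  | add_one o ih =>
    intro h
    rcases h.eq_or_lt with rfl | h
    · exact subset_rfl
    · rw [cbD_add_one]
      exact (cbDerivedSet_subset _).trans (ih (Order.lt_add_one_iff.1 h))
  | limit o ho ih =>
    intro h
    rcases h.eq_or_lt with rfl | h
    · exact subset_rfl
    · rw [cbD_limit A ho]
      exact Set.iInter_subset (fun p : {o' : Ordinal.{0} // o' < o} => cbD A p.1) ⟨a, h⟩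

theorem cbD_cbRank_eq {E : Type} [TopologicalSpace E] (A : Set E) :
    cbD A (cbRank A) = cbD A (cbRank A + 1) := by
  have hne : {o : Ordinal.{0} | cbD A o = cbD A (o + 1)}.Nonempty := by
    by_contra hempty
    rw [Set.not_nonempty_iff_eq_empty, Set.eq_empty_iff_forall_notMem] at hempty
    have key : ∀ a b : Ordinal.{0}, a < b → cbD A a ≠ cbD A b := fun a b hab heq =>
      hempty a ((heq.trans_le (cbD_antitone A (Order.add_one_le_of_lt hab))).antisymm
        (cbD_antitone A le_self_add))
    refine not_injective_of_ordinal (cbD A) fun a b hab => ?_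
    rcases lt_trichotomy a b with h | h | h
    · exact absurd hab (key a b h)
    · exact h
    · exact absurd hab.symm (key b a h)
  exact csInf_mem hne

theorem IsClosed.cbDerivedSet [T1Space E] {A : Set E} (hA : IsClosed A) :
    IsClosed (cbDerivedSet A) := by
  rw [← isOpen_compl_iff, isOpen_iff_mem_nhds]
  intro x hx
  by_cases hxA : x ∈ A
  · have hcl : x ∈ (closure (A \ {x}))ᶜ := fun h => hx ⟨hxA, h⟩
    filter_upwards [isClosed_closure.isOpen_compl.mem_nhds hcl] with y hy hyd
    by_cases hyx : y = x
    · exact hx (hyx ▸ hyd)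
    · exact hy (subset_closure ⟨hyd.1, hyx⟩)
  · filter_upwards [hA.isOpen_compl.mem_nhds hxA] with y hy hyd
    exact hy hyd.1

theorem isClosed_cbD_nat [T1Space E] {A : Set E} (hA : IsClosed A) (n : ℕ) :
    IsClosed (cbD A n) := by
  induction n with
  | zero => simpa [cbD_zero] using hA
  | succ n ih =>
    rw [Nat.cast_succ, cbD_add_one]
    exact ih.cbDerivedSet

theorem exists_nat_cbD_eq_empty {E : Type} [TopologicalSpace E] [CompactSpace E] [T2Space E]
    {A : Set E} (hA : IsClosed A) (hcount : A.Countable) (hrank : cbRank A < Ordinal.omega0) :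
    ∃ n : ℕ, cbD A n = ∅ := by
  obtain ⟨n, hn⟩ := Ordinal.lt_omega0.1 hrank
  refine ⟨n, ?_⟩
  by_contra hne
  have heq := cbD_cbRank_eq A
  rw [hn, cbD_add_one] at heq
  have hsub : cbD A n ⊆ A := by
    simpa only [cbD_zero] using cbD_antitone A (zero_le (a := (n : Ordinal.{0})))
  obtain ⟨z, hz, U, hU, hzU, hUz⟩ := exists_isolated_of_subset_countable_isClosed hA hcount hsub
    (Set.nonempty_iff_ne_empty.2 hne)
  rw [heq] at hz
  obtain ⟨w, hwU, hw, hwz⟩ := mem_closure_iff.1 hz.2 U hU hzU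
  exact hwz (hUz ⟨hwU, hw⟩)

/-- If a finite derivative of `A` is empty, the points of `A` carry a bounded rank that drops
strictly near each point. -/
theorem exists_rank_of_cbD_eq_empty {A : Set E} {n : ℕ} (hn : cbD A n = ∅) :
    ∃ rk : E → ℕ, (∀ y, rk y ≤ n) ∧
      ∀ y ∈ A, ∃ U, IsOpen U ∧ y ∈ U ∧ ∀ z ∈ U, z ∈ A → z = y ∨ rk z < rk y := by
  classical
  have hex : ∀ y : E, ∃ i : ℕ, y ∉ cbD A i := fun y => ⟨n, by simp [hn]⟩
  refine ⟨fun y => Nat.find (hex y), fun y => Nat.find_min' _ (by simp [hn]), fun y hy => ?_⟩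
  obtain ⟨r, hr⟩ : ∃ r, Nat.find (hex y) = r + 1 := by
    refine Nat.exists_eq_succ_of_ne_zero fun h0 => ?_
    have := Nat.find_spec (hex y)
    rw [h0, Nat.cast_zero, cbD_zero] at this
    exact this hy
  have hmem : y ∈ cbD A r := not_not.1 (Nat.find_min (hex y) (by omega))
  have hnot : y ∉ cbDerivedSet (cbD A r) := by
    have := Nat.find_spec (hex y)
    rwa [hr, Nat.cast_succ, cbD_add_one] at this
  refine ⟨(closure (cbD A r \ {y}))ᶜ, isClosed_closure.isOpen_compl, fun h => hnot ⟨hmem, h⟩,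
    fun z hz _ => ?_⟩
  by_cases hzy : z = y
  · exact Or.inl hzy
  · refine Or.inr ?_
    have hzr : z ∉ cbD A r := fun h => hz (subset_closure ⟨h, hzy⟩)
    have := Nat.find_min' (hex z) hzr
    change Nat.find (hex z) < Nat.find (hex y)
    omega

end CantorBendixson

/-! ### Vertical gluing in two-dimensional subshifts -/

section Layered

variable {S : Type*}

/-- `x` and `y` agree on the horizontal strip of height `h` based at level `0`. -/
def StripEq (h : ℤ) (x y : ℤ × ℤ → S) : Prop :=
  ∀ a b : ℤ, 0 ≤ b → b < h → x (a, b) = y (a, b)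

theorem StripEq.symm {h : ℤ} {x y : ℤ × ℤ → S} (H : StripEq h x y) : StripEq h y x :=
  fun a b h0 h1 => (H a b h0 h1).symm

theorem StripEq.trans {h : ℤ} {x y z : ℤ × ℤ → S} (H : StripEq h x y) (H' : StripEq h y z) :
    StripEq h x z :=
  fun a b h0 h1 => (H a b h0 h1).trans (H' a b h0 h1)

/-- A countable subshift in which half-planes overlapping in a strip of height `h` can be glued. -/
structure IsCountableLayered [TopologicalSpace S] (X : Set (ℤ × ℤ → S)) (h : ℤ) : Prop where
  height_nonneg : 0 ≤ h
  isClosed : IsClosed X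
  countable : X.Countable
  shift_mem : ∀ x ∈ X, ∀ n, shift2 n x ∈ X
  glue_mem : ∀ x ∈ X, ∀ y ∈ X, StripEq h x y → (fun p => if 0 ≤ p.2 then x p else y p) ∈ X

theorem shift2_shift2 (m n : ℤ × ℤ) (x : ℤ × ℤ → S) :
    shift2 m (shift2 n x) = shift2 (n + m) x := by
  funext p
  simp only [shift2, add_assoc]

theorem IsSFT2.isCountableLayered [TopologicalSpace S] [DiscreteTopology S]
    {X : Set (ℤ × ℤ → S)} (hX : IsSFT2 X) (hc : X.Countable) : ∃ h : ℤ, IsCountableLayered X h := by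
  obtain ⟨F, hF, rfl⟩ := hX
  obtain ⟨H, hH0, hH⟩ : ∃ H : ℤ, 0 ≤ H ∧ ∀ P ∈ F, ∀ m ∈ P.1, |m.2| ≤ H := by
    have hfin : (⋃ P ∈ F, (fun m : ℤ × ℤ => |m.2|) '' (P.1 : Set (ℤ × ℤ))).Finite :=
      hF.biUnion fun P _ => P.1.finite_toSet.image _
    obtain ⟨H, hH⟩ := hfin.bddAbove
    refine ⟨max 0 H, le_max_left _ _, fun P hP m hm => (hH ?_).trans (le_max_right _ _)⟩
    simp only [Set.mem_iUnion]
    exact ⟨P, hP, m, hm, rfl⟩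
  refine ⟨2 * H, ⟨by linarith, ?_, hc, ?_, ?_⟩⟩
  · have : {x : ℤ × ℤ → S | ∀ P ∈ F, ¬ occurs2 P.1 P.2 x} =
        ⋂ P ∈ F, ⋂ n : ℤ × ℤ, {x | ∀ m ∈ P.1, x (n + m) = P.2 m}ᶜ := by
      ext x
      simp only [occurs2, Set.mem_ofPred_eq, Set.mem_iInter, Set.mem_compl_iff, not_exists]
    rw [this]
    refine isClosed_biInter fun P _ => isClosed_iInter fun n => ?_
    refine IsOpen.isClosed_compl (s := {x : ℤ × ℤ → S | ∀ m ∈ P.1, x (n + m) = P.2 m}) ?_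
    have hset : {x : ℤ × ℤ → S | ∀ m ∈ P.1, x (n + m) = P.2 m} =
        (fun x => shift2 n x) ⁻¹' {x | ∀ m ∈ P.1, x m = P.2 m} := rfl
    rw [hset]
    exact (isOpen_setOf_forall_finset_eq _ _).preimage
      (continuous_pi fun p => continuous_apply (n + p))
  · rintro x hx n P hP ⟨k, hk⟩
    exact hx P hP ⟨n + k, fun m hm => by rw [add_assoc]; exact hk m hm⟩
  · rintro x hx y hy hxy P hP ⟨n, hn⟩
    by_cases hlow : H ≤ n.2
    · refine hx P hP ⟨n, fun m hm => ?_⟩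
      rw [← hn m hm]
      have := abs_le.1 (hH P hP m hm)
      exact (if_pos (by rw [Prod.snd_add]; linarith)).symm
    · refine hy P hP ⟨n, fun m hm => ?_⟩
      rw [← hn m hm]
      have := abs_le.1 (hH P hP m hm)
      beta_reduce
      split_ifs with h0
      · exact (hxy _ _ h0 (by rw [Prod.snd_add]; linarith)).symm
      · rfl

variable [TopologicalSpace S] [DiscreteTopology S]

/-- Configurations that return infinitely often upwards to a strip have the same upper half-plane
above that strip. -/
theorem IsCountableLayered.upper_eq_of_recurrent [Finite S] {X : Set (ℤ × ℤ → S)} {h : ℤ}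
    (hX : IsCountableLayered X h) {w x y : ℤ × ℤ → S}
    (hx : x ∈ X ∧ StripEq h x w ∧ ∀ N : ℤ, ∃ n : ℤ × ℤ, N ≤ n.2 ∧ StripEq h (shift2 n x) w)
    (hy : y ∈ X ∧ StripEq h y w ∧ ∀ N : ℤ, ∃ n : ℤ × ℤ, N ≤ n.2 ∧ StripEq h (shift2 n y) w)
    (p : ℤ × ℤ) (hp : 0 ≤ p.2) : x p = y p := by
  set V : Set (ℤ × ℤ → S) := {x | x ∈ X ∧ StripEq h x w ∧
    ∀ N : ℤ, ∃ n : ℤ × ℤ, N ≤ n.2 ∧ StripEq h (shift2 n x) w} with hV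
  obtain ⟨z, hzV, U, hU, hzU, hUV⟩ := exists_isolated_of_subset_countable_isClosed hX.isClosed
    hX.countable (V := V) (fun _ h => h.1) ⟨x, hx⟩
  obtain ⟨D, hD⟩ := hU.exists_finset_forall_eq_mem hzU
  obtain ⟨N, hN⟩ : ∃ N : ℤ, ∀ m ∈ D, m.2 < N := by
    obtain ⟨N, hN⟩ := (D.finite_toSet.image Prod.snd).bddAbove
    exact ⟨N + 1, fun m hm => Int.lt_add_one_iff.2 (hN ⟨m, hm, rfl⟩)⟩
  obtain ⟨n, hn, hnz⟩ := hzV.2.2 (max 0 N)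
  obtain ⟨hn0, hn⟩ := max_le_iff.1 hn
  have key : ∀ u ∈ V, ∀ p : ℤ × ℤ, 0 ≤ p.2 → u p = z (n + p) := by
    intro u hu
    set g : ℤ × ℤ → S := fun p => if 0 ≤ p.2 then u p else shift2 n z p with hg
    have hstrip : StripEq h u (shift2 n z) := hu.2.1.trans hnz.symm
    have hgX : g ∈ X := hX.glue_mem u hu.1 _ (hX.shift_mem z hzV.1 n) hstrip
    have hlow : ∀ p : ℤ × ℤ, p.2 < h ∨ p.2 < 0 → g p = z (n + p) := by
      intro p hp
      simp only [hg]
      split_ifs with h0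
      · exact hstrip p.1 p.2 h0 (hp.resolve_right (not_lt.2 h0))
      · rfl
    have hgup : ∀ p : ℤ × ℤ, 0 ≤ p.2 → g p = u p := fun p h0 => if_pos h0
    have hgV : shift2 (-n) g ∈ V := by
      refine ⟨hX.shift_mem g hgX _, ?_, fun N' => ?_⟩
      · intro a b h0 h1
        rw [← hzV.2.1 a b h0 h1]
        refine (hlow (-n + (a, b)) (Or.inl ?_)).trans (by rw [add_neg_cancel_left])
        simp only [Prod.snd_add, Prod.snd_neg]
        linarith
      · obtain ⟨m, hm, hmu⟩ := hu.2.2 (max 0 (N' - n.2))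
        refine ⟨n + m, by rw [Prod.snd_add]; linarith [le_max_right 0 (N' - n.2)], ?_⟩
        rw [shift2_shift2, neg_add_cancel_left]
        intro a b h0 h1
        rw [← hmu a b h0 h1]
        refine hgup (m + (a, b)) ?_
        rw [Prod.snd_add]
        linarith [le_max_left 0 (N' - n.2)]
    have hgz : shift2 (-n) g = z := by
      refine hUV ⟨hD _ fun m hm => ?_, hgV⟩
      refine (hlow (-n + m) (Or.inr ?_)).trans (by rw [add_neg_cancel_left])
      have := hN m hm
      simp only [Prod.snd_add, Prod.snd_neg]
      linarith
    intro p h0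
    rw [← hgup p h0, ← hgz, shift2, neg_add_cancel_left]
  rw [key x hx p hp, key y hy p hp]

end Layered

/-! ### Limits of shifts -/

section ShiftLimit

variable {S : Type*}

theorem exists_forall_finset_of_antitone {ι κ : Type*} {T : Set κ} (hT : T.Finite)
    {R : κ → Finset ι → Prop} (hR : ∀ k D D', D ⊆ D' → R k D' → R k D)
    (h : ∀ D, ∃ k ∈ T, R k D) : ∃ k ∈ T, ∀ D, R k D := by
  classical
  by_contra! hcon
  choose! D hD using hcon
  obtain ⟨k, hk, hRk⟩ := h (hT.toFinset.biUnion D)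
  exact hD k hk (hR k _ _ (Finset.subset_biUnion_of_mem D (hT.mem_toFinset.2 hk)) hRk)

/-- `y` is a limit of shifts of `x` by vectors satisfying `P`. -/
def IsShiftLimit (P : ℤ × ℤ → Prop) (x y : ℤ × ℤ → S) : Prop :=
  ∀ D : Finset (ℤ × ℤ), ∃ n, P n ∧ ∀ m ∈ D, x (n + m) = y m

theorem patLE2.isShiftLimit {x y : ℤ × ℤ → S} (h : patLE2 y x) :
    IsShiftLimit (fun _ => True) x y := by
  intro D
  obtain ⟨n, hn⟩ := h D 0
  exact ⟨n, trivial, fun m hm => by rw [hn m hm, zero_add]⟩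

theorem IsShiftLimit.mono {P Q : ℤ × ℤ → Prop} {x y : ℤ × ℤ → S} (h : IsShiftLimit P x y)
    (hPQ : ∀ n, P n → Q n) : IsShiftLimit Q x y := fun D =>
  let ⟨n, hn, hD⟩ := h D
  ⟨n, hPQ n hn, hD⟩

theorem IsShiftLimit.or {P Q : ℤ × ℤ → Prop} {x y : ℤ × ℤ → S}
    (h : IsShiftLimit (fun n => P n ∨ Q n) x y) : IsShiftLimit P x y ∨ IsShiftLimit Q x y := by
  classical
  by_contra! hcon
  simp only [IsShiftLimit, not_forall] at hcon
  obtain ⟨⟨D, hD⟩, D', hD'⟩ := hcon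
  obtain ⟨n, hn, hm⟩ := h (D ∪ D')
  rcases hn with hn | hn
  · exact hD ⟨n, hn, fun m hmD => hm m (Finset.mem_union_left _ hmD)⟩
  · exact hD' ⟨n, hn, fun m hmD => hm m (Finset.mem_union_right _ hmD)⟩

theorem IsShiftLimit.exists_eq_shift2 {P : ℤ × ℤ → Prop} (hP : {n | P n}.Finite)
    {x y : ℤ × ℤ → S} (h : IsShiftLimit P x y) : ∃ n, y = shift2 n x := by
  obtain ⟨n, -, hn⟩ := exists_forall_finset_of_antitone (ι := ℤ × ℤ) hP
    (R := fun n D => ∀ m ∈ D, x (n + m) = y m) (fun _ _ _ hsub h m hm => h m (hsub hm)) h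
  exact ⟨n, funext fun m => (hn {m} m (Finset.mem_singleton_self m)).symm⟩

theorem patLE2_shift2 (n : ℤ × ℤ) (x : ℤ × ℤ → S) : patLE2 x (shift2 n x) := fun _ k =>
  ⟨-n + k, fun m _ => by rw [shift2, add_assoc, add_neg_cancel_left]⟩

theorem patLT2.not_isShiftLimit_of_finite {x y : ℤ × ℤ → S} (hxy : patLT2 y x)
    {P : ℤ × ℤ → Prop} (hP : {n | P n}.Finite) : ¬ IsShiftLimit P x y := by
  intro h
  obtain ⟨n, rfl⟩ := h.exists_eq_shift2 hP
  exact hxy.2 (patLE2_shift2 n x)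

/-- `y` is, up to a vertical shift, a limit of horizontal shifts of `x`. -/
def IsHorizontalLimit (x y : ℤ × ℤ → S) : Prop :=
  ∃ b : ℤ, IsShiftLimit (fun n => n.2 = b) x y

theorem IsShiftLimit.isHorizontalLimit {x y : ℤ × ℤ → S} {l u : ℤ}
    (h : IsShiftLimit (fun n => l ≤ n.2 ∧ n.2 ≤ u) x y) : IsHorizontalLimit x y := by
  obtain ⟨b, -, hb⟩ := exists_forall_finset_of_antitone (ι := ℤ × ℤ) (Set.finite_Icc l u)
    (R := fun b D => ∃ n : ℤ × ℤ, n.2 = b ∧ ∀ m ∈ D, x (n + m) = y m)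
    (fun _ _ _ hsub ⟨n, hn, h⟩ => ⟨n, hn, fun m hm => h m (hsub hm)⟩)
    fun D => let ⟨n, hn, hm⟩ := h D; ⟨n.2, hn, n, rfl, hm⟩
  exact ⟨b, hb⟩

/-- `x` has a period that is not horizontal. -/
def VerticallyPeriodic (x : ℤ × ℤ → S) : Prop :=
  ∃ t : ℤ × ℤ, 0 < t.2 ∧ ∀ p, x (p + t) = x p

theorem add_zsmul_eq_of_period {G : Type*} [AddGroup G] {x : G → S} {t : G}
    (ht : ∀ p, x (p + t) = x p) (p : G) (k : ℤ) : x (p + k • t) = x p := by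
  have := (show Function.Periodic x t from ht).zsmul k
  exact this p

theorem IsShiftLimit.period {P : ℤ × ℤ → Prop} {x y : ℤ × ℤ → S} (h : IsShiftLimit P x y)
    {t : ℤ × ℤ} (ht : ∀ p, x (p + t) = x p) (p : ℤ × ℤ) : y (p + t) = y p := by
  obtain ⟨n, -, hn⟩ := h {p, p + t}
  rw [← hn p (by simp), ← hn (p + t) (by simp), ← add_assoc, ht]

theorem VerticallyPeriodic.of_isShiftLimit {P : ℤ × ℤ → Prop} {x y : ℤ × ℤ → S}
    (hx : VerticallyPeriodic x) (h : IsShiftLimit P x y) : VerticallyPeriodic y :=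
  let ⟨t, ht0, ht⟩ := hx
  ⟨t, ht0, h.period ht⟩

theorem VerticallyPeriodic.isHorizontalLimit {P : ℤ × ℤ → Prop} {x y : ℤ × ℤ → S}
    (hx : VerticallyPeriodic x) (h : IsShiftLimit P x y) : IsHorizontalLimit x y := by
  obtain ⟨t, ht0, ht⟩ := hx
  refine IsShiftLimit.isHorizontalLimit (l := 0) (u := t.2) fun D => ?_
  obtain ⟨n, -, hn⟩ := h D
  refine ⟨n + (-(n.2 / t.2)) • t, ?_, fun m hm => ?_⟩
  · have h1 := Int.emod_nonneg n.2 ht0.ne'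
    have h2 := Int.emod_lt_of_pos n.2 ht0
    have h3 := Int.emod_add_mul_ediv n.2 t.2
    simp only [Prod.snd_add, Prod.smul_snd, smul_eq_mul]
    constructor <;> nlinarith
  · rw [← hn m hm, add_right_comm, add_zsmul_eq_of_period ht]

/-- Reflection of a configuration preserving the strip of levels `0, …, h - 1`. -/
def reflectStrip (h : ℤ) (x : ℤ × ℤ → S) : ℤ × ℤ → S := fun p => x (p.1, h - 1 - p.2)

theorem reflectStrip_reflectStrip (h : ℤ) (x : ℤ × ℤ → S) :
    reflectStrip h (reflectStrip h x) = x := by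
  funext p
  simp [reflectStrip]

variable [TopologicalSpace S] {X : Set (ℤ × ℤ → S)} {h : ℤ}

theorem IsCountableLayered.verticallyPeriodic_of_upward
    [DiscreteTopology S] [Finite S] (hX : IsCountableLayered X h)
    {x y : ℤ × ℤ → S} (hx : x ∈ X)
    (H : ∀ N : ℤ, IsShiftLimit (fun n => N ≤ n.2 ∧ StripEq h (shift2 n x) y) x y) :
    VerticallyPeriodic y := by
  have hrec : ∀ n, StripEq h (shift2 n x) y → shift2 n x ∈ X ∧ StripEq h (shift2 n x) y ∧
      ∀ N : ℤ, ∃ k : ℤ × ℤ, N ≤ k.2 ∧ StripEq h (shift2 k (shift2 n x)) y := by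
    refine fun n hn => ⟨hX.shift_mem x hx n, hn, fun N => ?_⟩
    obtain ⟨k, ⟨hk, hky⟩, -⟩ := H (N + n.2) ∅
    refine ⟨-n + k, ?_, by rwa [shift2_shift2, add_neg_cancel_left]⟩
    simp only [Prod.snd_add, Prod.snd_neg]
    linarith
  obtain ⟨n₁, ⟨-, h₁⟩, -⟩ := H 0 ∅
  obtain ⟨n₂, ⟨hlt, h₂⟩, -⟩ := H (n₁.2 + 1) ∅
  have heq := hX.upper_eq_of_recurrent (hrec n₁ h₁) (hrec n₂ h₂)
  refine ⟨n₂ - n₁, by rw [Prod.snd_sub]; linarith, fun p => ?_⟩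
  obtain ⟨n, ⟨hn, -⟩, hD⟩ := H (n₁.2 - p.2) {p, p + (n₂ - n₁)}
  rw [← hD p (by simp), ← hD (p + (n₂ - n₁)) (by simp)]
  have := heq (n + p - n₁) (by simp only [Prod.snd_add, Prod.snd_sub]; linarith)
  simp only [shift2] at this
  rw [add_sub_cancel] at this
  rw [this]
  congr 1
  abel

theorem IsCountableLayered.reflectStrip (hX : IsCountableLayered X h) :
    IsCountableLayered (reflectStrip h ⁻¹' X) h where
  height_nonneg := hX.height_nonneg
  isClosed := hX.isClosed.preimage (continuous_pi fun p => continuous_apply (p.1, h - 1 - p.2))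
  countable := hX.countable.preimage_of_injOn
    (Function.LeftInverse.injective (reflectStrip_reflectStrip h)).injOn
  shift_mem x hx n := by
    have : _root_.reflectStrip h (shift2 n x) =
        shift2 (n.1, -n.2) (_root_.reflectStrip h x) := by
      funext p
      simp only [_root_.reflectStrip, shift2, Prod.fst_add, Prod.snd_add]
      congr 1
      ext
      · rfl
      · simp only [Prod.snd_add]
        ring
    rw [Set.mem_preimage, this]
    exact hX.shift_mem _ hx _
  glue_mem x hx y hy hxy := by
    have hs : StripEq h (_root_.reflectStrip h y) (_root_.reflectStrip h x) := fun a b h0 h1 =>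
      (hxy a (h - 1 - b) (by linarith) (by linarith)).symm
    have := hX.glue_mem _ hy _ hx hs
    rw [Set.mem_preimage]
    convert this using 1
    funext p
    simp only [_root_.reflectStrip]
    split_ifs with h1 h2 h2
    · exact hxy _ _ h1 (by linarith)
    · rfl
    · rfl
    · have := hX.height_nonneg
      omega

theorem IsCountableLayered.verticallyPeriodic_of_downward
    [DiscreteTopology S] [Finite S] (hX : IsCountableLayered X h)
    {x y : ℤ × ℤ → S} (hx : x ∈ X)
    (H : ∀ N : ℤ, IsShiftLimit (fun n => n.2 ≤ N ∧ StripEq h (shift2 n x) y) x y) :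
    VerticallyPeriodic y := by
  classical
  have hrefl : ∀ n p : ℤ × ℤ, _root_.reflectStrip h x ((n.1, -n.2) + p) =
      x (n + (p.1, h - 1 - p.2)) := by
    intro n p
    simp only [_root_.reflectStrip]
    congr 1
    ext
    · rfl
    · simp only [Prod.snd_add]
      ring
  have hper : VerticallyPeriodic (_root_.reflectStrip h y) := by
    refine hX.reflectStrip.verticallyPeriodic_of_upward (x := _root_.reflectStrip h x) ?_ ?_
    · rwa [Set.mem_preimage, reflectStrip_reflectStrip]
    · intro N D
      obtain ⟨n, ⟨hn, hs⟩, hD⟩ := H (-N) (D.image fun p => (p.1, h - 1 - p.2))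
      refine ⟨(n.1, -n.2), ⟨by simp only; linarith, fun a b h0 h1 => ?_⟩, fun p hp => ?_⟩
      · rw [shift2, hrefl]
        exact hs a (h - 1 - b) (by linarith) (by linarith)
      · rw [hrefl]
        exact hD _ (Finset.mem_image_of_mem _ hp)
  obtain ⟨t, ht0, ht⟩ := hper
  refine ⟨(-t.1, t.2), ht0, fun p => ?_⟩
  have := ht (p.1 - t.1, h - 1 - p.2 - t.2)
  simp only [_root_.reflectStrip, Prod.fst_add, Prod.snd_add] at this
  rw [show p = (p.1 - t.1 + t.1, h - 1 - (h - 1 - p.2 - t.2 + t.2)) from by ext <;> simp, this]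
  congr 1
  ext
  · simp only [Prod.fst_add]
    ring
  · simp only [Prod.snd_add]
    ring

theorem IsCountableLayered.isHorizontalLimit_or_verticallyPeriodic
    [DiscreteTopology S] [Finite S] (hX : IsCountableLayered X h)
    {x y : ℤ × ℤ → S} (hx : x ∈ X)
    (H : IsShiftLimit (fun n => StripEq h (shift2 n x) y) x y) :
    IsHorizontalLimit x y ∨ VerticallyPeriodic y := by
  by_cases hup : ∀ N : ℤ, IsShiftLimit (fun n => N ≤ n.2 ∧ StripEq h (shift2 n x) y) x y
  · exact Or.inr (hX.verticallyPeriodic_of_upward hx hup)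
  by_cases hdown : ∀ N : ℤ, IsShiftLimit (fun n => n.2 ≤ N ∧ StripEq h (shift2 n x) y) x y
  · exact Or.inr (hX.verticallyPeriodic_of_downward hx hdown)
  push Not at hup hdown
  obtain ⟨N, hN⟩ := hup
  obtain ⟨M, hM⟩ := hdown
  have h1 := (H.mono (Q := fun n => (N ≤ n.2 ∧ StripEq h (shift2 n x) y) ∨
    ((n.2 ≤ M ∧ StripEq h (shift2 n x) y) ∨ (M ≤ n.2 ∧ n.2 ≤ N))) fun n hn => by
      by_cases hnN : N ≤ n.2
      · exact Or.inl ⟨hnN, hn⟩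
      by_cases hnM : n.2 ≤ M
      · exact Or.inr (Or.inl ⟨hnM, hn⟩)
      · exact Or.inr (Or.inr ⟨by linarith, by linarith⟩)).or.resolve_left hN
  exact Or.inl (h1.or.resolve_left hM).isHorizontalLimit

end ShiftLimit

/-! ### Rows -/

section Rows

variable {S : Type*}

theorem row_eq_row_shift2 (x : ℤ × ℤ → S) (j : ℤ) : row x j = row (shift2 (0, j) x) 0 := by
  funext a
  simp [row, shift2]

theorem exists_int_shift_eq_of_eq {y : ℤ → S} {a b : ℤ} (hab : a < b)
    (h : ∀ m, y (a + m) = y (b + m)) : ∃ p : ℤ, 0 < p ∧ ∀ m, y (m + p) = y m := by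
  refine ⟨b - a, by linarith, fun m => ?_⟩
  have := h (m - a)
  rw [add_sub_cancel] at this
  rw [this]
  congr 1
  ring

variable [TopologicalSpace S] {X : Set (ℤ × ℤ → S)} {h : ℤ}

theorem IsCountableLayered.row_mem (hX : IsCountableLayered X h) {x : ℤ × ℤ → S} (hx : x ∈ X)
    (j : ℤ) : row x j ∈ PS2 X :=
  ⟨_, hX.shift_mem x hx (0, j), (row_eq_row_shift2 x j).symm⟩

theorem isClosed_PS2 [DiscreteTopology S] [Finite S] (hX : IsClosed X) : IsClosed (PS2 X) :=
  (hX.isCompact.image (continuous_pi fun _ => continuous_apply _)).isClosed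

/-- A bounded rank on rows yields a bounded rank on configurations that is monotone under the
subpattern preorder and whose stationarity forces exact recurrence of a strip. -/
theorem IsCountableLayered.exists_strip_rank (hX : IsCountableLayered X h) {N : ℕ}
    (hN : cbD (PS2 X) N = ∅) :
    ∃ ρ : (ℤ × ℤ → S) → ℕ, (∃ B, ∀ x, ρ x ≤ B) ∧
      ∀ x ∈ X, ∀ y ∈ X, patLE2 y x → ρ x ≤ ρ y ∧
        (ρ x = ρ y → ∃ k, IsShiftLimit (fun n => StripEq h (shift2 n x) (shift2 k y))
          x (shift2 k y)) := by
  classical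
  obtain ⟨rk, hle, hrk⟩ := exists_rank_of_cbD_eq_empty hN
  set I := Finset.range h.toNat
  set s : (ℤ × ℤ → S) → ℕ := fun x => ∑ b ∈ I, rk (row x b) with hs
  set ρ : (ℤ × ℤ → S) → ℕ := fun x => sInf (Set.range fun n => s (shift2 n x)) with hρ
  have hρle : ∀ x n, ρ x ≤ s (shift2 n x) := fun x n => Nat.sInf_le ⟨n, rfl⟩
  have hρmem : ∀ x, ∃ n, s (shift2 n x) = ρ x := fun x => Nat.sInf_mem (Set.range_nonempty _)
  have hloc : ∀ y ∈ X, ∃ D : Finset (ℤ × ℤ), ∀ z ∈ X, (∀ m ∈ D, z m = y m) →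
      ∀ b ∈ I, row z b = row y b ∨ rk (row z b) < rk (row y b) := by
    intro y hy
    choose U hU hyU hUz using fun j : ℕ => hrk (row y j) (hX.row_mem hy j)
    choose D hD using fun j => (hU j).exists_finset_forall_eq_mem (hyU j)
    refine ⟨I.biUnion fun b => (D b).image fun a => (a, (b : ℤ)), fun z hz hzy b hb => ?_⟩
    refine hUz b _ (hD b _ fun a ha => hzy _ ?_) (hX.row_mem hz b)
    exact Finset.mem_biUnion.2 ⟨b, hb, Finset.mem_image_of_mem _ ha⟩
  refine ⟨ρ, ⟨I.card * N, fun x => ?_⟩, fun x hx y hy hxy => ?_⟩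
  · exact (hρle x 0).trans ((Finset.sum_le_sum fun b _ => hle _).trans (by simp))
  · obtain ⟨k, hk⟩ := hρmem y
    obtain ⟨D, hD⟩ := hloc (shift2 k y) (hX.shift_mem y hy k)
    have hlim : IsShiftLimit (fun n => ∀ b ∈ I, row (shift2 n x) b = row (shift2 k y) b ∨
        rk (row (shift2 n x) b) < rk (row (shift2 k y) b)) x (shift2 k y) := by
      intro D'
      obtain ⟨n, hn⟩ := hxy (D ∪ D') k
      exact ⟨n, hD _ (hX.shift_mem x hx n) fun m hm => hn m (Finset.mem_union_left _ hm),
        fun m hm => hn m (Finset.mem_union_right _ hm)⟩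
    have hrow : ∀ n b, (row (shift2 n x) b = row (shift2 k y) b ∨
        rk (row (shift2 n x) b) < rk (row (shift2 k y) b)) →
        rk (row (shift2 n x) b) ≤ rk (row (shift2 k y) b) := fun n b hb =>
      hb.elim (fun h => h ▸ le_rfl) le_of_lt
    constructor
    · obtain ⟨n, hn, -⟩ := hlim ∅
      rw [← hk]
      exact (hρle x n).trans (Finset.sum_le_sum fun b hb => hrow n b (hn b hb))
    · intro heq
      refine ⟨k, hlim.mono fun n hn a b h0 h1 => ?_⟩
      have hb : b.toNat ∈ I := Finset.mem_range.2 (by omega)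
      have hrows : row (shift2 n x) (b.toNat : ℤ) = row (shift2 k y) (b.toNat : ℤ) := by
        refine (hn _ hb).resolve_right fun hlt => ?_
        have : s (shift2 n x) < s (shift2 k y) :=
          Finset.sum_lt_sum (fun b hb => hrow n b (hn b hb)) ⟨_, hb, hlt⟩
        have := hρle x n
        omega
      rw [Int.toNat_of_nonneg h0] at hrows
      exact congrFun hrows a

variable [DiscreteTopology S]

theorem shift_mem_cbDerivedSet {A : Set (ℤ → S)}
    (hA : ∀ y ∈ A, ∀ a : ℤ, (fun m => y (a + m)) ∈ A) :
    ∀ y ∈ cbDerivedSet A, ∀ a : ℤ, (fun m => y (a + m)) ∈ cbDerivedSet A := by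
  classical
  refine fun y hy a => ⟨hA y hy.1 a, mem_closure_iff_forall_finset.2 fun D => ?_⟩
  obtain ⟨z, ⟨hz, hzy⟩, hD⟩ := mem_closure_iff_forall_finset.1 hy.2 (D.image fun m => a + m)
  refine ⟨fun m => z (a + m), ⟨hA z hz a, fun heq => hzy ?_⟩,
    fun m hm => hD _ (Finset.mem_image_of_mem _ hm)⟩
  refine Set.mem_singleton_iff.2 (funext fun m => ?_)
  simpa using congrFun (Set.mem_singleton_iff.1 heq) (-a + m)

theorem IsCountableLayered.shift_mem_cbD_PS2 (hX : IsCountableLayered X h) (i : ℕ) :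
    ∀ y ∈ cbD (PS2 X) i, ∀ a : ℤ, (fun m => y (a + m)) ∈ cbD (PS2 X) i := by
  induction i with
  | zero =>
    rw [Nat.cast_zero, cbD_zero]
    rintro _ ⟨x, hx, rfl⟩ a
    exact ⟨_, hX.shift_mem x hx (a, 0), by funext m; simp [row, shift2]⟩
  | succ i ih =>
    rw [Nat.cast_succ, cbD_add_one]
    exact shift_mem_cbDerivedSet ih

/-- Along a strict step by horizontal limits, each row becomes periodic or gains a derivative. -/
theorem IsCountableLayered.row_periodic_or_mem_cbD [Finite S] (hX : IsCountableLayered X h) {i : ℕ}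
    {x y : ℤ × ℤ → S} (hxy : patLT2 y x) (hlim : IsHorizontalLimit x y)
    (H : ∀ j, (∃ p : ℤ, 0 < p ∧ ∀ m, row x j (m + p) = row x j m) ∨ row x j ∈ cbD (PS2 X) i)
    (j : ℤ) :
    (∃ p : ℤ, 0 < p ∧ ∀ m, row y j (m + p) = row y j m) ∨
      row y j ∈ cbD (PS2 X) (i + 1 : ℕ) := by
  classical
  obtain ⟨b, hb⟩ := hlim
  have hrow : ∀ (A : ℤ) (D : Finset ℤ), ∃ a : ℤ, A < a.natAbs ∧
      ∀ m ∈ D, row x (b + j) (a + m) = row y j m := by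
    intro A D
    have hfin : {n : ℤ × ℤ | n.2 = b ∧ (n.1.natAbs : ℤ) ≤ A}.Finite := by
      refine ((Set.finite_Icc (-A) A).prod (Set.finite_singleton b)).subset ?_
      rintro n ⟨h1, h2⟩
      refine ⟨⟨?_, ?_⟩, h1⟩ <;> omega
    have h1 := (hb.mono (Q := fun n => (n.2 = b ∧ (n.1.natAbs : ℤ) ≤ A) ∨
      (n.2 = b ∧ A < n.1.natAbs)) fun n hn => by
        rcases le_or_gt (n.1.natAbs : ℤ) A with h | h
        · exact Or.inl ⟨hn, h⟩
        · exact Or.inr ⟨hn, h⟩).or.resolve_left (hxy.not_isShiftLimit_of_finite hfin)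
    obtain ⟨⟨a, b'⟩, ⟨rfl, ha⟩, hD⟩ := h1 (D.image fun m => (m, j))
    exact ⟨a, ha, fun m hm => hD _ (Finset.mem_image_of_mem _ hm)⟩
  rcases H (b + j) with ⟨p, hp, hper⟩ | hmem
  · refine Or.inl ⟨p, hp, fun m => ?_⟩
    obtain ⟨a, -, ha⟩ := hrow 0 {m, m + p}
    rw [← ha m (by simp), ← ha (m + p) (by simp), ← add_assoc, hper]
  · by_cases hex : ∃ D : Finset ℤ, ∀ a : ℤ, (∀ m ∈ D, row x (b + j) (a + m) = row y j m) →
        ∀ m, row x (b + j) (a + m) = row y j m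
    · obtain ⟨D, hD⟩ := hex
      obtain ⟨a, -, ha⟩ := hrow 0 D
      obtain ⟨a', ha', haD'⟩ := hrow a.natAbs D
      have hne : a ≠ a' := by
        rintro rfl
        exact lt_irrefl _ ha'
      have hper : ∃ p : ℤ, 0 < p ∧ ∀ m, row x (b + j) (m + p) = row x (b + j) m := by
        rcases hne.lt_or_gt with h | h
        · exact exists_int_shift_eq_of_eq h fun m => (hD a ha m).trans (hD a' haD' m).symm
        · exact exists_int_shift_eq_of_eq h fun m => (hD a' haD' m).trans (hD a ha m).symm
      obtain ⟨p, hp, hper⟩ := hper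
      refine Or.inl ⟨p, hp, fun m => ?_⟩
      rw [← hD a ha, ← hD a ha, ← add_assoc, hper]
    · push Not at hex
      refine Or.inr ?_
      have hcl : row y j ∈ closure (cbD (PS2 X) i \ {row y j}) := by
        refine mem_closure_iff_forall_finset.2 fun D => ?_
        obtain ⟨a, ha, m, hm⟩ := hex D
        exact ⟨_, ⟨hX.shift_mem_cbD_PS2 i _ hmem a, fun h => hm (congrFun h m)⟩, ha⟩
      rw [Nat.cast_succ, cbD_add_one]
      refine ⟨?_, hcl⟩
      rw [← (isClosed_cbD_nat (isClosed_PS2 hX.isClosed) i).closure_eq]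
      exact closure_mono Set.sdiff_subset hcl

/-- If every row is horizontally periodic, so is the whole configuration. -/
theorem IsCountableLayered.exists_horizontal_period [Finite S] (hX : IsCountableLayered X h)
    {x : ℤ × ℤ → S} (hx : x ∈ X)
    (H : ∀ j, ∃ p : ℤ, 0 < p ∧ ∀ m, row x j (m + p) = row x j m) :
    ∃ p : ℤ, 0 < p ∧ ∀ q, x (q + (p, 0)) = x q := by
  classical
  choose p hp hper using H
  obtain ⟨z, ⟨a, rfl⟩, U, hU, hzU, hUz⟩ := exists_isolated_of_subset_countable_isClosed
    hX.isClosed hX.countable (V := Set.range fun a : ℤ => shift2 (a, 0) x)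
    (by rintro _ ⟨a, rfl⟩; exact hX.shift_mem x hx _) (Set.range_nonempty _)
  obtain ⟨D, hD⟩ := hU.exists_finset_forall_eq_mem hzU
  refine ⟨∏ j ∈ D.image Prod.snd, p j, Finset.prod_pos fun j _ => hp j, fun q => ?_⟩
  set t := ∏ j ∈ D.image Prod.snd, p j
  have hmem : shift2 (a + t, 0) x ∈ U := by
    refine hD _ fun m hm => ?_
    obtain ⟨k, hk⟩ := Finset.dvd_prod_of_mem p (Finset.mem_image_of_mem Prod.snd hm)
    have := add_zsmul_eq_of_period (hper m.2) (a + m.1) k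
    simp only [row, smul_eq_mul] at this
    simp only [shift2]
    rw [show (a + t, (0 : ℤ)) + m = (a + m.1 + k * p m.2, m.2) from by
      ext
      · simp only [Prod.fst_add, t, hk]
        ring
      · simp, this]
    congr 1
    ext <;> simp
  have heq := congrFun (Set.mem_singleton_iff.1 (hUz ⟨hmem, a + t, rfl⟩)) (q - (a, 0))
  simp only [shift2] at heq
  rw [add_sub_cancel] at heq
  rw [← heq]
  congr 1
  ext
  · simp only [Prod.fst_add, Prod.fst_sub]
    ring
  · simp

theorem IsHorizontalLimit.not_horizontal_period {S : Type*} {x y : ℤ × ℤ → S}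
    (hlim : IsHorizontalLimit x y) (hxy : patLT2 y x) :
    ¬ ∃ p : ℤ, 0 < p ∧ ∀ q, x (q + (p, 0)) = x q := by
  rintro ⟨p, hp, hper⟩
  obtain ⟨b, hb⟩ := hlim
  have hfin : {n : ℤ × ℤ | n ∈ Set.Icc 0 p ×ˢ ({b} : Set ℤ)}.Finite :=
    ((Set.finite_Icc 0 p).prod (Set.finite_singleton b))
  refine hxy.not_isShiftLimit_of_finite hfin fun D => ?_
  obtain ⟨n, rfl, hn⟩ := hb D
  refine ⟨n + (-(n.1 / p)) • (p, 0), ⟨⟨?_, ?_⟩, ?_⟩, fun m hm => ?_⟩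
  · have h1 := Int.emod_nonneg n.1 hp.ne'
    have h3 := Int.emod_add_mul_ediv n.1 p
    simp only [Prod.fst_add, Prod.smul_fst, smul_eq_mul]
    linarith
  · have h2 := Int.emod_lt_of_pos n.1 hp
    have h3 := Int.emod_add_mul_ediv n.1 p
    simp only [Prod.fst_add, Prod.smul_fst, smul_eq_mul]
    linarith
  · simp
  · rw [← hn m hm, add_right_comm, add_zsmul_eq_of_period hper]

end Rows

/-! ### Descending chains -/

theorem exists_forall_ge_eq_succ_of_monotone_of_le {f : ℕ → ℕ} (hf : Monotone f) {B : ℕ}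
    (hB : ∀ i, f i ≤ B) : ∃ i₀, ∀ i, i₀ ≤ i → f i = f (i + 1) := by
  refine ⟨Function.argmin fun i => B - f i, fun i hi => ?_⟩
  have h1 := Function.argmin_le (fun i => B - f i) (i + 1)
  have h2 := hf hi
  have h3 := hf (Nat.le_succ i)
  have h4 := hB (i + 1)
  simp only [Nat.succ_eq_add_one] at h1 h2 h3 h4
  omega

theorem IsCountableLayered.cbD_PS2_ne_empty {S : Type*} [Finite S] [TopologicalSpace S]
    [DiscreteTopology S] {X : Set (ℤ × ℤ → S)} {h : ℤ} (hX : IsCountableLayered X h)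
    (x : ℕ → ℤ × ℤ → S) (hmem : ∀ k, x k ∈ X) (hchain : ∀ k, patLT2 (x (k + 1)) (x k)) (N : ℕ) :
    cbD (PS2 X) N ≠ ∅ := by
  intro hN
  obtain ⟨ρ, ⟨B, hB⟩, hρ⟩ := hX.exists_strip_rank hN
  obtain ⟨i₀, hi₀⟩ := exists_forall_ge_eq_succ_of_monotone_of_le (f := fun i => ρ (x i))
    (monotone_nat_of_le_succ fun i => (hρ _ (hmem i) _ (hmem (i + 1)) (hchain i).1).1)
    (fun i => hB _)
  have hstep : ∀ i, i₀ ≤ i →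
      IsHorizontalLimit (x i) (x (i + 1)) ∨ VerticallyPeriodic (x (i + 1)) := by
    intro i hi
    obtain ⟨k, hk⟩ := (hρ _ (hmem i) _ (hmem (i + 1)) (hchain i).1).2 (hi₀ i hi)
    have hback : shift2 (-k) (shift2 k (x (i + 1))) = x (i + 1) := by
      funext p
      simp [shift2]
    rcases hX.isHorizontalLimit_or_verticallyPeriodic (hmem i) hk with ⟨b, hb⟩ | ⟨t, ht0, ht⟩
    · refine Or.inl ⟨b + (-k).2, fun D => ?_⟩
      classical
      obtain ⟨n, hn, hD⟩ := hb (D.image fun m => -k + m)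
      refine ⟨n + -k, congrArg (· + (-k).2) hn, fun m hm => ?_⟩
      rw [add_assoc, hD _ (Finset.mem_image_of_mem _ hm), shift2, add_neg_cancel_left]
    · refine Or.inr ⟨t, ht0, fun p => ?_⟩
      have := ht (-k + p)
      simpa only [shift2, add_assoc, add_neg_cancel_left] using this
  obtain ⟨i₁, hi₁⟩ : ∃ i₁, ∀ i, i₁ ≤ i → IsHorizontalLimit (x i) (x (i + 1)) := by
    by_cases hper : ∃ i, VerticallyPeriodic (x i)
    · obtain ⟨i, hi⟩ := hper
      have hall : ∀ j, i ≤ j → VerticallyPeriodic (x j) := fun j hj =>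
        Nat.le_induction hi (fun j _ ih => ih.of_isShiftLimit (hchain j).1.isShiftLimit) j hj
      exact ⟨i, fun j hj => (hall j hj).isHorizontalLimit (hchain j).1.isShiftLimit⟩
    · push Not at hper
      exact ⟨i₀, fun i hi => (hstep i hi).resolve_right (hper _)⟩
  have hrows : ∀ i : ℕ, ∀ j, (∃ p : ℤ, 0 < p ∧ ∀ m, row (x (i₁ + i)) j (m + p) =
      row (x (i₁ + i)) j m) ∨ row (x (i₁ + i)) j ∈ cbD (PS2 X) i := by
    intro i
    induction i with
    | zero =>
      intro j
      rw [Nat.cast_zero, cbD_zero]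
      exact Or.inr (hX.row_mem (hmem _) j)
    | succ i ih =>
      exact hX.row_periodic_or_mem_cbD (hchain (i₁ + i)) (hi₁ _ (Nat.le_add_right _ _)) ih
  refine (hi₁ (i₁ + N) (Nat.le_add_right _ _)).not_horizontal_period (hchain _)
    (hX.exists_horizontal_period (hmem _) fun j => (hrows N j).resolve_right ?_)
  simp [hN]

/-! ### Linear changes of coordinates -/

section ChangeOfCoordinates

theorem sl2Vec_add (A : Matrix.SpecialLinearGroup (Fin 2) ℤ) (v w : ℤ × ℤ) :
    sl2Vec A (v + w) = sl2Vec A v + sl2Vec A w := by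
  ext <;> simp only [sl2Vec, Prod.fst_add, Prod.snd_add] <;> ring

theorem sl2Vec_mul (A B : Matrix.SpecialLinearGroup (Fin 2) ℤ) (v : ℤ × ℤ) :
    sl2Vec (A * B) v = sl2Vec A (sl2Vec B v) := by
  ext <;> simp only [sl2Vec, Matrix.SpecialLinearGroup.coe_mul, Matrix.mul_apply,
    Fin.sum_univ_two] <;> ring

theorem sl2Vec_one (v : ℤ × ℤ) : sl2Vec 1 v = v := by
  ext <;> simp [sl2Vec]

theorem sl2Vec_inv_sl2Vec (A : Matrix.SpecialLinearGroup (Fin 2) ℤ) (v : ℤ × ℤ) :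
    sl2Vec A⁻¹ (sl2Vec A v) = v := by
  rw [← sl2Vec_mul, inv_mul_cancel, sl2Vec_one]

theorem sl2Vec_sl2Vec_inv (A : Matrix.SpecialLinearGroup (Fin 2) ℤ) (v : ℤ × ℤ) :
    sl2Vec A (sl2Vec A⁻¹ v) = v := by
  rw [← sl2Vec_mul, mul_inv_cancel, sl2Vec_one]

variable {S : Type*}

theorem confAct_inv_confAct (A : Matrix.SpecialLinearGroup (Fin 2) ℤ) (x : ℤ × ℤ → S) :
    confAct A⁻¹ (confAct A x) = x := by
  funext n
  rw [confAct, confAct, inv_inv, sl2Vec_inv_sl2Vec]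

theorem confAct_confAct_inv (A : Matrix.SpecialLinearGroup (Fin 2) ℤ) (x : ℤ × ℤ → S) :
    confAct A (confAct A⁻¹ x) = x := by
  simpa only [inv_inv] using confAct_inv_confAct A⁻¹ x

theorem patLE2.confAct {x y : ℤ × ℤ → S} (hxy : patLE2 x y)
    (A : Matrix.SpecialLinearGroup (Fin 2) ℤ) : patLE2 (confAct A x) (confAct A y) := by
  classical
  intro D n
  obtain ⟨k, hk⟩ := hxy (D.image (sl2Vec A⁻¹)) (sl2Vec A⁻¹ n)
  refine ⟨sl2Vec A k, fun m hm => ?_⟩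
  rw [_root_.confAct, _root_.confAct, sl2Vec_add, sl2Vec_add, sl2Vec_inv_sl2Vec]
  exact hk _ (Finset.mem_image_of_mem _ hm)

theorem patLT2.confAct {x y : ℤ × ℤ → S} (hxy : patLT2 x y)
    (A : Matrix.SpecialLinearGroup (Fin 2) ℤ) : patLT2 (confAct A x) (confAct A y) :=
  ⟨hxy.1.confAct A, fun h => hxy.2 (by
    simpa only [confAct_inv_confAct] using h.confAct A⁻¹)⟩

theorem occurs2_confAct_iff [DecidableEq (ℤ × ℤ)] (A : Matrix.SpecialLinearGroup (Fin 2) ℤ)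
    (D : Finset (ℤ × ℤ)) (p x : ℤ × ℤ → S) :
    occurs2 (D.image (sl2Vec A)) (confAct A p) x ↔ occurs2 D p (confAct A⁻¹ x) := by
  constructor
  · rintro ⟨n, hn⟩
    refine ⟨sl2Vec A⁻¹ n, fun m hm => ?_⟩
    rw [confAct, inv_inv, sl2Vec_add, sl2Vec_sl2Vec_inv, hn _ (Finset.mem_image_of_mem _ hm),
      confAct, sl2Vec_inv_sl2Vec]
  · rintro ⟨n, hn⟩
    refine ⟨sl2Vec A n, fun m hm => ?_⟩
    obtain ⟨k, hk, rfl⟩ := Finset.mem_image.1 hm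
    rw [confAct, sl2Vec_inv_sl2Vec, ← hn k hk, confAct, inv_inv, sl2Vec_add]

theorem IsSFT2.image_confAct {X : Set (ℤ × ℤ → S)} (hX : IsSFT2 X)
    (A : Matrix.SpecialLinearGroup (Fin 2) ℤ) : IsSFT2 (confAct A '' X) := by
  classical
  obtain ⟨F, hF, rfl⟩ := hX
  refine ⟨(fun P => (P.1.image (sl2Vec A), confAct A P.2)) '' F, hF.image _, ?_⟩
  ext x
  simp only [Set.mem_image, Set.mem_ofPred_eq, forall_exists_index, and_imp,
    forall_apply_eq_imp_iff₂, occurs2_confAct_iff]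
  constructor
  · rintro ⟨y, hy, rfl⟩
    rwa [confAct_inv_confAct]
  · exact fun hx => ⟨_, hx, confAct_confAct_inv A x⟩

end ChangeOfCoordinates

/-- If a countable two-dimensional SFT has an infinite strictly descending
chain in its subpattern poset, then its projective subdynamics in every direction has
Cantor–Bendixson rank at least `ω`. -/
theorem rank_ge_omega_of_descending_chain {S : Type} [Fintype S] [TopologicalSpace S]
    [DiscreteTopology S] (X : Set (ℤ × ℤ → S)) (hX : IsSFT2 X) (hc : X.Countable)
    (x : ℕ → ℤ × ℤ → S) (hmem : ∀ k, x k ∈ X) (hchain : ∀ k, patLT2 (x (k + 1)) (x k)) :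
    ∀ d : ℤ × ℤ, IsCoprime d.1 d.2 →
      ∀ A : Matrix.SpecialLinearGroup (Fin 2) ℤ, sl2Vec A (rot90 d) = (0, 1) →
        Ordinal.omega0 ≤ cbRank (PS2 ((confAct A) '' X)) := by
  intro d _ A _
  by_contra hlt
  obtain ⟨h, hlayer⟩ := (hX.image_confAct A).isCountableLayered (hc.image _)
  obtain ⟨n, hn⟩ := exists_nat_cbD_eq_empty (isClosed_PS2 hlayer.isClosed)
    (hlayer.countable.image _) (not_le.1 hlt)
  exact hlayer.cbD_PS2_ne_empty (fun k => confAct A (x k)) (fun k => ⟨x k, hmem k, rfl⟩)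
    (fun k => (hchain k).confAct A) n hn
end

section
/- For every finite poset (P, ≥) there exists a countable two-dimensional SFT X, deterministic in some direction and with the P-property, such that P order-embeds into the subpattern poset SP(X). -/
section Machine

variable {K : Type} [PartialOrder K] [OrderBot K] (z : K) (σ : K → Equiv.Perm K)

open Classical in
/-- The cell below `m`, given its left and right neighbours. A cell is a colour with a head mark:
`0` (the head is further right), `1` (head in its searching phase, moving right), `2` (head in its
filling phase, moving left), `3` (the head is further left). -/
noncomputable def cellBelow (l m r : K × Fin 4) : K × Fin 4 :=
  if m.2 = 1 then (if m.1 = z then (z, 0) else (σ r.1 m.1, 2))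
  else if m.2 = 2 then (if l.1 = z then (m.1, 3) else (m.1, 1))
  else if m.2 = 3 then (if l.2 = 1 ∧ l.1 = z then (m.1, 1) else m)
  else if r.2 = 2 ∧ m.1 = z then (r.1, 2) else m

open Classical in
/-- The cell above `m`, given its left and right neighbours. -/
noncomputable def cellAbove (l m r : K × Fin 4) : K × Fin 4 :=
  if m.2 = 1 then (if l.1 = ⊥ then (m.1, 2) else (m.1, 3))
  else if m.2 = 2 then (if r.1 = m.1 then (z, 0) else ((σ r.1).symm m.1, 1))
  else if m.2 = 3 then (if l.2 = 2 ∧ l.1 = m.1 then (m.1, 2) else m)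
  else if r.2 = 1 ∧ m.1 ≠ ⊥ then (m.1, 1) else m

/-- The row below `x`. -/
noncomputable def rowBelow (x : ℤ → K × Fin 4) : ℤ → K × Fin 4 :=
  fun a => cellBelow z σ (x (a - 1)) (x a) (x (a + 1))

/-- The row above `x`. -/
noncomputable def rowAbove (x : ℤ → K × Fin 4) : ℤ → K × Fin 4 :=
  fun a => cellAbove z σ (x (a - 1)) (x a) (x (a + 1))

/-- `y` may stand immediately below `x`. -/
def RowStep (x y : ℤ → K × Fin 4) : Prop :=
  y = rowBelow z σ x ∧ x = rowAbove z σ y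

/-- The row with tape `c` and a head in phase `s` at position `j`. -/
def headRow (c : ℤ → K) (j : ℤ) (s : Fin 4) : ℤ → K × Fin 4 :=
  fun a => (c a, if a < j then 0 else if a = j then s else 3)

/-- The space-time diagrams of the machine with nondecreasing rows. -/
def diagrams : Set (ℤ × ℤ → K × Fin 4) :=
  {x | ∀ a b : ℤ, x (a, b) ≤ x (a + 1, b) ∧
    x (a, b - 1) = cellBelow z σ (x (a - 1, b)) (x (a, b)) (x (a + 1, b)) ∧
    x (a, b + 1) = cellAbove z σ (x (a - 1, b)) (x (a, b)) (x (a + 1, b))}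

/-- The tape which is `⊥` at negative positions, `q` on `[0, n)`, and `c` from `n` on. -/
def blockTape (n : ℤ) (q : K) (c : ℤ → K) : ℤ → K :=
  fun a => if a < 0 then ⊥ else if a < n then q else c a

/-- The colours at least `z` are all colours but `⊥`, and `σ p` permutes `[z, p]` cyclically,
mapping `z` to `p`. -/
structure IsColourSystem : Prop where
  bot_lt : ⊥ < z
  le_of_ne_bot : ∀ k : K, k ≠ ⊥ → z ≤ k
  isCycleOn : ∀ p, z < p → (σ p).IsCycleOn (Set.Icc z p)
  apply_z : ∀ p, z < p → σ p z = p

variable {z σ}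

theorem rowStep_search (h : ⊥ < z) {c : ℤ → K} {j : ℤ} (hc : c j = z) :
    RowStep z σ (headRow c j 1) (headRow c (j + 1) 1) := by
  have := h.ne
  constructor <;> funext a <;>
    rcases lt_trichotomy a j with h1 | rfl | h1 <;>
    grind [rowBelow, rowAbove, cellBelow, cellAbove, headRow]

theorem rowStep_turn {c : ℤ → K} {j : ℤ} (hc : c j ≠ z)
    (hq : σ (c (j + 1)) (c j) ≠ c (j + 1)) :
    RowStep z σ (headRow c j 1)
      (headRow (Function.update c j (σ (c (j + 1)) (c j))) j 2) := by
  obtain ⟨c', hc'⟩ : ∃ c', c' = Function.update c j (σ (c (j + 1)) (c j)) := ⟨_, rfl⟩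
  have h0 : c' j = σ (c (j + 1)) (c j) := by simp [hc']
  have h1 : ∀ a, a ≠ j → c' a = c a := fun a ha => by simp [hc', ha]
  rw [← hc']
  have h2 := h1 (j + 1) (by simp)
  clear hc'
  constructor <;> funext a <;>
    rcases lt_trichotomy a j with h3 | rfl | h3 <;>
    grind [rowBelow, rowAbove, cellBelow, cellAbove, headRow, Equiv.symm_apply_apply]

theorem rowStep_fill {c : ℤ → K} {j : ℤ} (hc : c (j - 1) = z) :
    RowStep z σ (headRow c j 2) (headRow (Function.update c (j - 1) (c j)) (j - 1) 2) := by
  obtain ⟨c', hc'⟩ : ∃ c', c' = Function.update c (j - 1) (c j) := ⟨_, rfl⟩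
  have h0 : c' (j - 1) = c j := by simp [hc']
  have h1 : ∀ a, a ≠ j - 1 → c' a = c a := fun a ha => by simp [hc', ha]
  rw [← hc']
  have h2 := h1 j (by lia)
  clear hc'
  constructor <;> funext a <;>
    rcases lt_trichotomy a j with h3 | rfl | h3 <;>
    grind [rowBelow, rowAbove, cellBelow, cellAbove, headRow]

theorem rowStep_wall (h : ⊥ < z) {c : ℤ → K} {j : ℤ} (hc : c (j - 1) = ⊥) :
    RowStep z σ (headRow c j 2) (headRow c j 1) := by
  have := h.ne
  constructor <;> funext a <;>
    rcases lt_trichotomy a j with h1 | rfl | h1 <;>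
    grind [rowBelow, rowAbove, cellBelow, cellAbove, headRow]

namespace IsColourSystem

theorem apply_mem (h : IsColourSystem z σ) {p q : K} (hq : q ∈ Set.Icc z p) (hqz : q ≠ z) :
    σ p q ∈ Set.Icc z p ∧ σ p q ≠ p := by
  have hp : z < p := (lt_of_le_of_ne hq.1 hqz.symm).trans_le hq.2
  refine ⟨(h.isCycleOn p hp).1.mapsTo hq, fun he => hqz ?_⟩
  exact (σ p).injective (he.trans (h.apply_z p hp).symm)

/-- Induction along the cycle `σ p` from `p` to `z`. -/
theorem cycle_induction [Finite K] (h : IsColourSystem z σ) {p : K} (hp : z ≤ p) {T : K → Prop}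
    (h0 : T p) (h1 : ∀ q ∈ Set.Icc z p, q ≠ z → T q → T (σ p q)) :
    ∀ q ∈ Set.Icc z p, T q := by
  rcases hp.eq_or_lt with rfl | hp'
  · rintro q ⟨hq, hq'⟩
    rwa [le_antisymm hq' hq]
  have hc := h.isCycleOn p hp'
  have hT : ∀ n : ℕ, ((σ p) ^ n) p ∈ Set.Icc z p ∧ T (((σ p) ^ n) p) := by
    intro n
    induction n with
    | zero => exact ⟨⟨hp, le_rfl⟩, h0⟩
    | succ n ih =>
      rw [pow_succ', Equiv.Perm.mul_apply]
      refine ⟨hc.1.mapsTo ih.1, ?_⟩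
      by_cases hz : ((σ p) ^ n) p = z
      · rwa [hz, h.apply_z p hp']
      · exact h1 _ ih.1 hz ih.2
  intro q hq
  obtain ⟨n, rfl⟩ := hc.exists_pow_eq' (Set.toFinite _) ⟨hp, le_rfl⟩ hq
  exact (hT n).2

end IsColourSystem

variable (z) in
/-- The rows that the machine can produce from tapes with colours at most `p`. -/
def ReachableForm (p : K) (x : ℤ → K × Fin 4) : Prop :=
  ∃ (c : ℤ → K) (j : ℤ) (s : Fin 4), x = headRow c j s ∧ (s = 1 ∨ s = 2) ∧ 0 ≤ j ∧
    (∀ a < 0, c a = ⊥) ∧ (∀ a, 0 ≤ a → a < j → c a = z) ∧ (∀ a, j ≤ a → z ≤ c a) ∧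
    (∀ a, j ≤ a → c a ≤ c (a + 1)) ∧ ∀ a, c a ≤ p

theorem ReachableForm.rowStep (h : IsColourSystem z σ) {p : K} {x : ℤ → K × Fin 4}
    (hx : ReachableForm z p x) : RowStep z σ x (rowBelow z σ x) ∧
      ReachableForm z p (rowBelow z σ x) := by
  suffices ∃ y, RowStep z σ x y ∧ ReachableForm z p y by
    obtain ⟨y, hy, hy'⟩ := this
    rw [← hy.1]
    exact ⟨hy, hy'⟩
  obtain ⟨c, j, s, rfl, hs, hj, hneg, hz, hle, hmono, hp⟩ := hx
  have hbot := h.bot_lt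
  rcases hs with rfl | rfl
  · by_cases hc : c j = z
    · refine ⟨_, rowStep_search hbot hc, c, j + 1, 1, rfl, by simp, by lia, hneg, ?_,
        fun a ha => hle a (by lia), fun a ha => hmono a (by lia), hp⟩
      intro a ha haj
      rcases eq_or_ne a j with rfl | hne
      · exact hc
      · exact hz a ha (by lia)
    · have hq := h.apply_mem ⟨hle j le_rfl, hmono j le_rfl⟩ hc
      refine ⟨_, rowStep_turn hc hq.2, _, j, 2, rfl, by simp, hj, ?_, ?_, ?_, ?_, ?_⟩
      · intro a ha
        simpa [show a ≠ j by lia] using hneg a ha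
      · intro a ha haj
        simpa [haj.ne] using hz a ha haj
      · intro a ha
        rcases eq_or_ne a j with rfl | hne
        · simpa using hq.1.1
        · simpa [hne] using hle a ha
      · intro a ha
        rcases eq_or_ne a j with rfl | hne
        · simpa using hq.1.2
        · simpa [hne, show a + 1 ≠ j by lia] using hmono a ha
      · intro a
        rcases eq_or_ne a j with rfl | hne
        · simpa using hq.1.2.trans (hp _)
        · simpa [hne] using hp a
  · rcases hj.eq_or_lt with rfl | hj'
    · exact ⟨_, rowStep_wall hbot (hneg _ (by lia)), c, 0, 1, rfl, by simp, le_rfl, hneg, hz, hle,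
        hmono, hp⟩
    · refine ⟨_, rowStep_fill (hz (j - 1) (by lia) (by lia)), _, j - 1, 2, rfl, by simp, by lia,
        ?_, ?_, ?_, ?_, ?_⟩
      · intro a ha
        simpa [show a ≠ j - 1 by lia] using hneg a ha
      · intro a ha haj
        simpa [haj.ne] using hz a ha (by lia)
      · intro a ha
        rcases eq_or_ne a (j - 1) with rfl | hne
        · simpa using hle j le_rfl
        · simpa [hne] using hle a (by lia)
      · intro a ha
        rcases eq_or_ne a (j - 1) with rfl | hne
        · simp [show j ≠ j - 1 by lia]
        · simpa [hne, show a + 1 ≠ j - 1 by lia] using hmono a (by lia)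
      · intro a
        rcases eq_or_ne a (j - 1) with rfl | hne
        · simpa using hp j
        · simpa [hne] using hp a

theorem ReachableForm.le_succ {p : K} {x : ℤ → K × Fin 4}
    (hx : ReachableForm z p x) (a : ℤ) : x a ≤ x (a + 1) := by
  obtain ⟨c, j, s, rfl, hs, hj, hneg, hz, hle, hmono, hp⟩ := hx
  refine Prod.mk_le_mk.2 ⟨?_, ?_⟩
  · rcases lt_or_ge a 0 with ha | ha
    · rw [hneg a ha]
      exact bot_le
    rcases lt_or_ge a j with haj | haj
    · rw [hz a ha haj]
      rcases lt_or_ge (a + 1) j with haj' | haj'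
      · rw [hz _ (by lia) haj']
      · exact hle _ haj'
    · exact hmono a haj
  · rcases hs with rfl | rfl <;> grind

theorem blockTape_of_neg {n : ℤ} {q : K} {c : ℤ → K} {a : ℤ} (ha : a < 0) :
    blockTape n q c a = ⊥ := if_pos ha

theorem blockTape_of_lt {n : ℤ} {q : K} {c : ℤ → K} {a : ℤ} (ha : 0 ≤ a) (han : a < n) :
    blockTape n q c a = q := by simp [blockTape, ha.not_gt, han]

theorem blockTape_of_ge {n : ℤ} {q : K} {c : ℤ → K} {a : ℤ} (ha : 0 ≤ a) (han : n ≤ a) :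
    blockTape n q c a = c a := by simp [blockTape, ha.not_gt, han.not_gt]

theorem blockTape_congr {n : ℤ} {q : K} {c c' : ℤ → K} (h : ∀ a, n ≤ a → c a = c' a) :
    blockTape n q c = blockTape n q c' := by
  funext a
  simp only [blockTape]
  split_ifs
  · rfl
  · rfl
  · exact h a (by lia)

theorem blockTape_succ {n : ℤ} {q : K} {c : ℤ → K} (hc : c n = q) :
    blockTape (n + 1) q c = blockTape n q c := by
  funext a
  simp only [blockTape]
  grind

open Relation

theorem reflTransGen_search (h : ⊥ < z) {c : ℤ → K} (n : ℕ)
    (hc : ∀ a : ℤ, 0 ≤ a → a < n → c a = z) :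
    ReflTransGen (RowStep z σ) (headRow c 0 1) (headRow c n 1) := by
  induction n with
  | zero => exact .refl
  | succ n ih =>
    push_cast at hc ⊢
    exact (ih fun a ha han => hc a ha (by lia)).tail (rowStep_search h (hc n (by lia) (by lia)))

theorem reflTransGen_fill (n : ℕ) {c : ℤ → K} {q : K} (hneg : ∀ a < 0, c a = ⊥)
    (hc : ∀ a : ℤ, 0 ≤ a → a < n → c a = z) (hq : c n = q) :
    ReflTransGen (RowStep z σ) (headRow c n 2) (headRow (blockTape n q c) 0 2) := by
  induction n generalizing c with
  | zero =>
    rw [show blockTape ((0 : ℕ) : ℤ) q c = c by funext a; simp only [blockTape]; grind]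
    exact .refl
  | succ n ih =>
    push_cast at hc hq ⊢
    have hs := rowStep_fill (z := z) (σ := σ) (c := c) (j := n + 1)
      (hc _ (by lia) (by lia))
    rw [show (n : ℤ) + 1 - 1 = n by ring, hq] at hs
    refine .head hs ?_
    convert ih (c := Function.update c n q) ?_ ?_ ?_ using 2
    · funext a
      simp only [blockTape, Function.update_apply]
      grind
    · intro a ha
      simpa [show a ≠ n by lia] using hneg a ha
    · intro a ha han
      simpa [han.ne] using hc a ha (by lia)
    · simp

/-- One sweep of the head replaces `zⁿ q p` by `(σ p q)ⁿ⁺¹ p`. -/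
theorem reflTransGen_sweep (h : IsColourSystem z σ) (n : ℕ) {c : ℤ → K} {p q : K}
    (hcn : c n = q) (hcp : c (n + 1) = p) (hq : q ∈ Set.Icc z p) (hqz : q ≠ z) :
    ReflTransGen (RowStep z σ) (headRow (blockTape n z c) 0 1)
      (headRow (blockTape (n + 1) (σ p q) c) 0 1) := by
  have hbn : blockTape n z c n = q := by rw [blockTape_of_ge (by lia) le_rfl, hcn]
  have hbp : blockTape n z c (n + 1) = p := by rw [blockTape_of_ge (by lia) (by lia), hcp]
  refine (reflTransGen_search h.bot_lt n fun a ha han => blockTape_of_lt ha han).trans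
    (.head (rowStep_turn (by rwa [hbn]) ?_) ?_)
  · rw [hbn, hbp]
    exact (h.apply_mem hq hqz).2
  rw [hbn, hbp]
  have hfill := reflTransGen_fill (z := z) (σ := σ) n
    (c := Function.update (blockTape n z c) n (σ p q)) (q := σ p q) ?_ ?_ (by simp)
  · have he : blockTape n (σ p q) (Function.update (blockTape n z c) n (σ p q)) =
        blockTape (n + 1) (σ p q) c := by
      funext a
      simp only [blockTape, Function.update_apply]
      grind
    rw [he] at hfill
    exact hfill.tail (rowStep_wall h.bot_lt (blockTape_of_neg (by lia)))
  · intro a ha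
    simpa [show a ≠ n by lia] using blockTape_of_neg ha
  · intro a ha han
    simpa [han.ne] using blockTape_of_lt ha han

/-- If the machine can turn `qⁿ⁺¹` into `zⁿ q` for all `q`, then it runs through all colours
`r ≤ p` to the left of a cell of colour `p`. -/
theorem reflTransGen_block_succ [Finite K] (h : IsColourSystem z σ) {n : ℕ}
    (ih : ∀ (q : K) (c : ℤ → K), z ≤ q → c n = q →
      ReflTransGen (RowStep z σ) (headRow (blockTape n q c) 0 1) (headRow (blockTape n z c) 0 1))
    {p : K} {c : ℤ → K} (hp : z ≤ p) (hc : c (n + 1) = p) {r : K} (hr : r ∈ Set.Icc z p) :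
    ReflTransGen (RowStep z σ) (headRow (blockTape (n + 1) p c) 0 1)
      (headRow (blockTape (n + 1) r c) 0 1) := by
  refine h.cycle_induction hp (T := fun r => ReflTransGen (RowStep z σ)
    (headRow (blockTape (n + 1) p c) 0 1) (headRow (blockTape (n + 1) r c) 0 1)) .refl ?_ r hr
  intro q hq hqz hT
  have hc' : ∀ a : ℤ, (n : ℤ) + 1 ≤ a → c a = Function.update c n q a := fun a ha => by
    simp [show a ≠ n by lia]
  have h1 := ih q (Function.update c n q) hq.1 (by simp)
  rw [← blockTape_succ (by simp), ← blockTape_congr hc'] at h1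
  refine hT.trans (h1.trans ?_)
  rw [blockTape_congr hc']
  exact reflTransGen_sweep h n (by simp) (by simpa using hc) hq hqz

theorem reflTransGen_block [Finite K] (h : IsColourSystem z σ) (n : ℕ) :
    ∀ (q : K) (c : ℤ → K), z ≤ q → c n = q →
      ReflTransGen (RowStep z σ) (headRow (blockTape n q c) 0 1)
        (headRow (blockTape n z c) 0 1) := by
  induction n with
  | zero =>
    intro q c _ _
    have : blockTape ((0 : ℕ) : ℤ) q c = blockTape ((0 : ℕ) : ℤ) z c := by
      funext a
      simp only [blockTape]
      grind
    rw [this]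
  | succ n ih =>
    intro q c hq hc
    push_cast at hc ⊢
    exact reflTransGen_block_succ h ih hq hc ⟨le_rfl, hq⟩

theorem exists_iterate_rowBelow {x y : ℤ → K × Fin 4} (hxy : ReflTransGen (RowStep z σ) x y) :
    ∃ n : ℕ, (rowBelow z σ)^[n] x = y := by
  induction hxy with
  | refl => exact ⟨0, rfl⟩
  | tail _ hs ih =>
    obtain ⟨n, rfl⟩ := ih
    exact ⟨n + 1, by rw [Function.iterate_succ_apply', hs.1]⟩

theorem mem_diagrams_iff {x : ℤ × ℤ → K × Fin 4} : x ∈ diagrams z σ ↔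
    ∀ b, (∀ a, x (a, b) ≤ x (a + 1, b)) ∧ RowStep z σ (row x (b + 1)) (row x b) := by
  refine ⟨fun h b => ⟨fun a => (h a b).1, ?_, ?_⟩, fun h a b => ⟨(h b).1 a, ?_, ?_⟩⟩
  · funext a
    simpa using! (h a (b + 1)).2.1
  · funext a
    exact (h a b).2.2
  · have := congrFun (h (b - 1)).2.1 a
    rwa [sub_add_cancel] at this
  · exact congrFun (h b).2.2 a

variable (z σ) in
/-- The run of the machine on the tape with all cells of colour `p`. -/
noncomputable def constRun (p : K) : ℤ × ℤ → K × Fin 4 := fun m =>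
  if m.2 ≤ 0 then (rowBelow z σ)^[(-m.2).toNat] (headRow (blockTape 0 z fun _ => p) 0 1) m.1
  else headRow (blockTape (m.2 - 1) z fun _ => p) (m.2 - 1) 2 m.1

theorem row_constRun_neg (p : K) (n : ℕ) : row (constRun z σ p) (-n) =
    (rowBelow z σ)^[n] (headRow (blockTape 0 z fun _ => p) 0 1) := by
  funext a
  simp [row, constRun]

theorem row_constRun_succ (p : K) (n : ℕ) : row (constRun z σ p) (n + 1) =
    headRow (blockTape n z fun _ => p) n 2 := by
  funext a
  simp [row, constRun, show ¬ ((n : ℤ) + 1 ≤ 0) by lia]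

theorem reachableForm_blockTape {p : K} (hp : z ≤ p) {s : Fin 4} (hs : s = 1 ∨ s = 2) (n : ℕ) :
    ReachableForm z p (headRow (blockTape n z fun _ => p) n s) := by
  refine ⟨_, n, s, rfl, hs, by lia, fun a ha => blockTape_of_neg ha,
    fun a ha han => blockTape_of_lt ha han, ?_, ?_, ?_⟩
  · intro a ha
    rwa [blockTape_of_ge (by lia) ha]
  · intro a ha
    rw [blockTape_of_ge (by lia) ha, blockTape_of_ge (by lia) (by lia)]
  · intro a
    simp only [blockTape]
    split_ifs
    exacts [bot_le, hp, le_rfl]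

theorem reachableForm_row_constRun (h : IsColourSystem z σ) {p : K} (hp : z ≤ p) (b : ℤ) :
    ReachableForm z p (row (constRun z σ p) b) := by
  rcases le_or_gt b 0 with hb | hb
  · obtain ⟨n, rfl⟩ := Int.exists_eq_neg_ofNat hb
    rw [row_constRun_neg]
    induction n with
    | zero => exact reachableForm_blockTape hp (Or.inl rfl) 0
    | succ n ih =>
      rw [Function.iterate_succ_apply']
      exact ((ih (by lia)).rowStep h).2
  · obtain ⟨n, rfl⟩ : ∃ n : ℕ, b = n + 1 := ⟨(b - 1).toNat, by lia⟩
    rw [row_constRun_succ]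
    exact reachableForm_blockTape hp (Or.inr rfl) n

theorem constRun_mem_diagrams (h : IsColourSystem z σ) {p : K} (hp : z ≤ p) :
    constRun z σ p ∈ diagrams z σ := by
  refine mem_diagrams_iff.2 fun b => ⟨(reachableForm_row_constRun h hp b).le_succ, ?_⟩
  rcases lt_or_ge b 0 with hb | hb
  · obtain ⟨n, rfl⟩ : ∃ n : ℕ, b = -((n + 1 : ℕ) : ℤ) := ⟨(-b - 1).toNat, by lia⟩
    rw [row_constRun_neg, Function.iterate_succ_apply', ← row_constRun_neg,
      show -((n + 1 : ℕ) : ℤ) + 1 = -n by push_cast; ring]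
    exact ((reachableForm_row_constRun h hp _).rowStep h).1
  · obtain ⟨n, rfl⟩ := Int.eq_ofNat_of_zero_le hb
    rw [row_constRun_succ]
    cases n with
    | zero =>
      have := row_constRun_neg (z := z) (σ := σ) p 0
      simp only [Nat.cast_zero, neg_zero, Function.iterate_zero, id] at this
      simp only [Nat.cast_zero, this]
      exact rowStep_wall h.bot_lt (blockTape_of_neg (by lia))
    | succ n =>
      push_cast
      rw [row_constRun_succ]
      convert rowStep_fill (c := blockTape ((n : ℤ) + 1) z fun _ => p) (j := (n : ℤ) + 1)
        (blockTape_of_lt (by lia) (by lia)) using 1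
      rw [add_sub_cancel_right]
      congr 1
      funext a
      simp only [blockTape, Function.update_apply]
      grind

/-- The row of the tape `q^∞` is approximated by rows of `constRun z σ p` for `q ≤ p`. -/
theorem exists_row_constRun_eq [Finite K] (h : IsColourSystem z σ) {p q : K} (hq : z ≤ q)
    (hqp : q ≤ p) (N : ℕ) : ∃ t : ℤ, ∀ a < (N : ℤ),
      constRun z σ p (a, t) = constRun z σ q (a, 0) := by
  have hp := hq.trans hqp
  obtain ⟨n, hn⟩ := exists_iterate_rowBelow (reflTransGen_block_succ h
    (reflTransGen_block h N) (c := fun _ => p) hp rfl ⟨hq, hqp⟩)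
  have he : blockTape ((N : ℤ) + 1) p (fun _ => p) = blockTape 0 z (fun _ => p) := by
    funext a
    simp only [blockTape]
    grind
  rw [he, ← row_constRun_neg] at hn
  refine ⟨-n, fun a ha => ?_⟩
  have h0 := congrFun (row_constRun_neg (z := z) (σ := σ) q 0) a
  have hn' := congrFun hn a
  simp only [row, Nat.cast_zero, neg_zero, Function.iterate_zero, id] at h0 hn'
  rw [h0, hn']
  simp only [headRow, blockTape]
  grind

/-- Rows propagate at most one cell per step. -/
theorem eq_of_row_eq {x y : ℤ × ℤ → K × Fin 4} (hx : x ∈ diagrams z σ) (hy : y ∈ diagrams z σ)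
    {N : ℤ} (h0 : ∀ a < N, x (a, 0) = y (a, 0)) {a b : ℤ} (hab : a + |b| < N) :
    x (a, b) = y (a, b) := by
  have key : ∀ k : ℕ, ∀ a, a + k < N →
      x (a, -k) = y (a, -k) ∧ x (a, (k : ℤ)) = y (a, (k : ℤ)) := by
    intro k
    induction k with
    | zero => intro a ha; simpa using h0 a (by simpa using ha)
    | succ k ih =>
      intro a ha
      push_cast at ha ⊢
      have h1 := ih (a - 1) (by lia)
      have h2 := ih a (by lia)
      have h3 := ih (a + 1) (by lia)
      constructor
      · rw [neg_add, ← sub_eq_add_neg, (hx a _).2.1, (hy a _).2.1, h1.1, h2.1, h3.1]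
      · rw [(hx a _).2.2, (hy a _).2.2, h1.2, h2.2, h3.2]
  rcases abs_choice b with hb | hb
  · simpa [Int.toNat_of_nonneg (abs_eq_self.1 hb)] using
      (key b.toNat a (by rw [Int.toNat_of_nonneg (abs_eq_self.1 hb)]; lia)).2
  · have hb' : 0 ≤ -b := hb ▸ abs_nonneg b
    simpa [Int.toNat_of_nonneg hb'] using
      (key (-b).toNat a (by rw [Int.toNat_of_nonneg hb']; lia)).1

theorem shift2_mem_diagrams {x : ℤ × ℤ → K × Fin 4} (hx : x ∈ diagrams z σ) (n : ℤ × ℤ) :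
    shift2 n x ∈ diagrams z σ := by
  intro a b
  obtain ⟨n₁, n₂⟩ := n
  simpa [shift2, add_assoc, add_sub_assoc] using hx (n₁ + a) (n₂ + b)

theorem patLE2_constRun [Finite K] (h : IsColourSystem z σ) {p q : K} (hq : z ≤ q) (hqp : q ≤ p) :
    patLE2 (constRun z σ q) (constRun z σ p) := by
  intro D n
  obtain ⟨N, hN⟩ := (D.finite_toSet.image fun m => ((n + m).1 + |(n + m).2|)).bddAbove
  obtain ⟨t, ht⟩ := exists_row_constRun_eq h hq hqp (N + 1).toNat
  refine ⟨(0, t) + n, fun m hm => ?_⟩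
  have hm' := hN ⟨m, hm, rfl⟩
  rw [add_assoc]
  refine eq_of_row_eq (a := (n + m).1) (b := (n + m).2) (N := N + 1)
    (shift2_mem_diagrams (constRun_mem_diagrams h (hq.trans hqp)) (0, t))
    (constRun_mem_diagrams h hq) (fun a ha => ?_) (by lia)
  simpa [shift2] using ht a (by lia)

theorem le_of_patLE2_constRun (h : IsColourSystem z σ) {p q : K} (hp : z ≤ p)
    (hpq : patLE2 (constRun z σ q) (constRun z σ p)) : q ≤ p := by
  obtain ⟨n, hn⟩ := hpq {0} 0
  have hn := hn 0 (Finset.mem_singleton_self 0)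
  obtain ⟨c, j, s, hc, -, -, -, -, -, -, hle⟩ := reachableForm_row_constRun h hp n.2
  have h0 := congrFun hc n.1
  have hq : constRun z σ q (0, 0) = (q, 1) := by simp [constRun, headRow, blockTape]
  simp only [row, add_zero] at h0 hn
  have : (headRow c j s n.1).1 = q := by
    rw [← h0, Prod.mk.eta, hn]
    exact congrArg Prod.fst hq
  exact this ▸ hle n.1

theorem countable_setOf_isUpperSet_int : {s : Set ℤ | IsUpperSet s}.Countable := by
  refine ((Set.countable_range (Set.Ici : ℤ → Set ℤ)).union
    (Set.toFinite {∅, Set.univ}).countable).mono fun s hs => ?_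
  rcases s.eq_empty_or_nonempty with rfl | hne
  · simp
  by_cases hb : BddBelow s
  · left
    obtain ⟨m, hm⟩ := hne
    exact ⟨sInf s, Set.Subset.antisymm (fun a ha => hs ha (Int.csInf_mem ⟨m, hm⟩ hb))
      fun a ha => csInf_le hb ha⟩
  · right; right
    refine Set.eq_univ_of_forall fun a => ?_
    obtain ⟨m, hm, hma⟩ := not_bddBelow_iff.1 hb a
    exact hs hma.le hm

theorem countable_setOf_monotone_int (A : Type*) [PartialOrder A] [Finite A] :
    {f : ℤ → A | Monotone f}.Countable := by
  have hc : (Set.univ.pi fun _ : A => {s : Set ℤ | IsUpperSet s}).Countable :=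
    Set.countable_univ_pi fun _ => countable_setOf_isUpperSet_int
  refine Set.MapsTo.countable_of_injOn (f := fun f a => {n : ℤ | a ≤ f n}) ?_ ?_ hc
  · intro f hf a _ m n hmn hm
    exact le_trans hm (hf hmn)
  · intro f _ g _ hfg
    funext n
    have : ∀ a, a ≤ f n ↔ a ≤ g n := fun a => Set.ext_iff.1 (congrFun hfg a) n
    exact le_antisymm ((this _).1 le_rfl) ((this _).2 le_rfl)

theorem isSFT1_setOf_monotone (A : Type*) [PartialOrder A] [Finite A] :
    IsSFT1 {f : ℤ → A | Monotone f} := by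
  refine ⟨(fun u : A × A => [u.1, u.2]) '' {u | ¬ u.1 ≤ u.2}, Set.toFinite _, ?_⟩
  ext f
  simp only [Set.mem_ofPred_eq, Set.forall_mem_image, occursW, occursAtW]
  constructor
  · rintro hf u hu ⟨n, hn⟩
    have h0 := hn ⟨0, by simp⟩
    have h1 := hn ⟨1, by simp⟩
    simp only [List.get_eq_getElem, Nat.cast_zero, add_zero, Nat.cast_one,
      List.getElem_cons_zero, List.getElem_cons_succ] at h0 h1
    exact hu (h0 ▸ h1 ▸ hf (by lia))
  · intro hf
    refine monotone_int_of_le_succ fun n => ?_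
    by_contra hn
    refine hf (x := (f n, f (n + 1))) hn ⟨n, fun i => ?_⟩
    match i with
    | ⟨0, _⟩ => simp
    | ⟨1, _⟩ => simp

/-- A set of configurations defined by a condition on a fixed finite window is a subshift of
finite type. -/
theorem isSFT2_of_window {S : Type*} [Finite S] [Nonempty S] (D : Finset (ℤ × ℤ))
    (Q : (ℤ × ℤ → S) → Prop) (hQ : ∀ x y : ℤ × ℤ → S, (∀ m ∈ D, x m = y m) → Q x → Q y) :
    IsSFT2 {x | ∀ n, Q (shift2 n x)} := by
  classical
  have s0 := Classical.arbitrary S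
  let ext (u : D → S) : ℤ × ℤ → S := fun m => if hm : m ∈ D then u ⟨m, hm⟩ else s0
  refine ⟨(fun u => (D, ext u)) '' {u | ¬ Q (ext u)}, Set.toFinite _, ?_⟩
  ext x
  simp only [Set.mem_ofPred_eq, Set.forall_mem_image, occurs2]
  constructor
  · rintro hx u hu ⟨n, hn⟩
    exact hu (hQ _ _ hn (hx n))
  · intro hx n
    by_contra hn
    have hext : ∀ m ∈ D, ext (fun m => x (n + m)) m = x (n + m) := fun m hm => dif_pos hm
    exact hx (x := fun m => x (n + m)) (fun hq => hn (hQ _ _ hext hq))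
      ⟨n, fun m hm => (hext m hm).symm⟩

theorem isSFT2_diagrams [Finite K] : IsSFT2 (diagrams z σ) := by
  classical
  convert isSFT2_of_window (S := K × Fin 4) {(0, 0), (1, 0), (-1, 0), (0, 1), (0, -1)}
    (fun x => x (0, 0) ≤ x (1, 0) ∧
      x (0, -1) = cellBelow z σ (x (-1, 0)) (x (0, 0)) (x (1, 0)) ∧
      x (0, 1) = cellAbove z σ (x (-1, 0)) (x (0, 0)) (x (1, 0))) ?_ using 1
  · ext x
    simp [diagrams, shift2, Prod.forall, sub_eq_add_neg]
  · intro x y hxy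
    simp only [Finset.mem_insert, Finset.mem_singleton, forall_eq_or_imp, forall_eq] at hxy
    obtain ⟨h1, h2, h3, h4, h5⟩ := hxy
    rw [h1, h2, h3, h4, h5]
    exact id

theorem monotone_row {x : ℤ × ℤ → K × Fin 4} (hx : x ∈ diagrams z σ) (b : ℤ) :
    Monotone (row x b) :=
  monotone_int_of_le_succ fun a => (hx a b).1

theorem countable_diagrams [Finite K] : (diagrams z σ).Countable := by
  refine Set.MapsTo.countable_of_injOn (f := fun x => row x 0)
    (fun x hx => monotone_row hx 0) ?_ (countable_setOf_monotone_int (K × Fin 4))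
  intro x hx y hy hxy
  funext ⟨a, b⟩
  exact eq_of_row_eq hx hy (fun a _ => congrFun hxy a) (lt_add_one _)

theorem southDet_diagrams : SouthDet (diagrams z σ) := by
  intro x hx y hy hxy
  have key : ∀ k : ℕ, ∀ a, x (a, 1 - k) = y (a, 1 - k) := by
    intro k
    induction k with
    | zero => intro a; exact hxy _ _ (by simp)
    | succ k ih =>
      intro a
      push_cast
      rw [← sub_sub, (hx a _).2.1, (hy a _).2.1, ih, ih, ih]
  funext ⟨a, b⟩
  rcases le_or_gt 1 b with hb | hb
  · exact hxy a b hb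
  · simpa [Int.toNat_of_nonneg (show 0 ≤ 1 - b by lia)] using key (1 - b).toNat a

theorem detSomeDir_of_southDet {S : Type*} {X : Set (ℤ × ℤ → S)} (h : SouthDet X) :
    DetSomeDir X := by
  refine ⟨(0, -1), isCoprime_zero_left.2 isUnit_one.neg, 1, by simp [sl2Vec, rot90], ?_⟩
  have : confAct (S := S) 1 = id := by
    funext x n
    simp [confAct, sl2Vec]
  rwa [this, Set.image_id]

theorem pProperty_of_PS2_subset {S : Type} [Fintype S] {X : Set (ℤ × ℤ → S)} {Y : Set (ℤ → S)}
    (hY : IsSFT1 Y) (hc : Y.Countable) (h : PS2 X ⊆ Y) : PProperty X :=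
  ⟨S, inferInstance, X, id, id, ⟨@continuous_id _ (_), @continuous_id _ (_)⟩, fun _ _ => rfl,
    fun _ _ => rfl, fun _ => id, fun _ => id, fun _ _ => rfl, fun _ _ => rfl, Y, hY, hc, h⟩

theorem pProperty_diagrams [Fintype K] : PProperty (diagrams z σ) := by
  refine pProperty_of_PS2_subset (isSFT1_setOf_monotone (K × Fin 4))
    (countable_setOf_monotone_int _) ?_
  rintro _ ⟨x, hx, rfl⟩
  exact monotone_row hx 0

end Machine

/-- Any two points of a finite set are consecutive in some cyclic ordering of it. -/
theorem exists_perm_isCycleOn_apply_eq {K : Type*} {s : Set K} (hs : s.Finite) {a b : K}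
    (ha : a ∈ s) (hb : b ∈ s) (hab : a ≠ b) :
    ∃ σ : Equiv.Perm K, σ.IsCycleOn s ∧ σ a = b := by
  classical
  obtain ⟨f, hf, -⟩ := hs.countable.exists_cycleOn
  have hfa : f a ≠ a := hf.apply_ne ⟨a, ha, b, hb, hab⟩ ha
  have hfs : f a ∈ s := hf.1.mapsTo ha
  refine ⟨Equiv.swap (f a) b * f * (Equiv.swap (f a) b)⁻¹, ?_, ?_⟩
  · convert hf.conj (g := Equiv.swap (f a) b)
    refine (Set.Subset.antisymm ?_ fun x hx => ?_).symm
    · rintro _ ⟨x, hx, rfl⟩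
      rw [Equiv.swap_apply_def]
      split_ifs <;> assumption
    · refine ⟨Equiv.swap (f a) b x, ?_, by simp⟩
      rw [Equiv.swap_apply_def]
      split_ifs <;> assumption
  · simp [Equiv.swap_apply_of_ne_of_ne hfa.symm hab]

theorem exists_isColourSystem (P : Type) [Finite P] [PartialOrder P] :
    ∃ σ : WithBot (WithBot P) → Equiv.Perm (WithBot (WithBot P)),
      IsColourSystem ((⊥ : WithBot P) : WithBot (WithBot P)) σ := by
  classical
  have hfin : Finite (WithBot (WithBot P)) := inferInstanceAs (Finite (Option (Option P)))
  have key : ∀ p : WithBot (WithBot P), ∃ σ : Equiv.Perm (WithBot (WithBot P)),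
      ((⊥ : WithBot P) : WithBot (WithBot P)) < p →
        σ.IsCycleOn (Set.Icc ((⊥ : WithBot P) : WithBot (WithBot P)) p) ∧
          σ ((⊥ : WithBot P) : WithBot (WithBot P)) = p := by
    intro p
    by_cases hp : ((⊥ : WithBot P) : WithBot (WithBot P)) < p
    · obtain ⟨σ, h1, h2⟩ := exists_perm_isCycleOn_apply_eq (Set.toFinite _)
        (Set.left_mem_Icc.2 hp.le) (Set.right_mem_Icc.2 hp.le) hp.ne
      exact ⟨σ, fun _ => ⟨h1, h2⟩⟩
    · exact ⟨1, fun h => absurd h hp⟩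
  choose σ hσ using key
  refine ⟨σ, WithBot.bot_lt_coe _, fun k hk => ?_, fun p hp => (hσ p hp).1, fun p hp => (hσ p hp).2⟩
  obtain ⟨k, rfl⟩ := WithBot.ne_bot_iff_exists.1 hk
  exact WithBot.coe_le_coe.2 bot_le

/-- For every finite poset `P` there is a countable two-dimensional SFT,
deterministic in some direction and with the P-property, whose subpattern poset contains an
order-embedded copy of `P`. -/
theorem finite_poset_embeds_in_SFT (P : Type) [Fintype P] [PartialOrder P] :
    ∃ (S : Type) (_ : Fintype S) (X : Set (ℤ × ℤ → S)),
      IsSFT2 X ∧ X.Countable ∧ DetSomeDir X ∧ PProperty X ∧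
      ∃ φ : P → ℤ × ℤ → S, (∀ p, φ p ∈ X) ∧
        ∀ p q : P, p ≤ q ↔ patLE2 (φ p) (φ q) := by
  obtain ⟨σ, hσ⟩ := exists_isColourSystem P
  let _ : Fintype (WithBot (WithBot P)) := inferInstanceAs (Fintype (Option (Option P)))
  have hle (p : P) : ((⊥ : WithBot P) : WithBot (WithBot P)) ≤ ((p : WithBot P) : WithBot _) :=
    WithBot.coe_le_coe.2 bot_le
  refine ⟨WithBot (WithBot P) × Fin 4, inferInstance, diagrams _ σ, isSFT2_diagrams,
    countable_diagrams, detSomeDir_of_southDet southDet_diagrams, pProperty_diagrams,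
    fun p => constRun _ σ ((p : WithBot P) : WithBot _),
    fun p => constRun_mem_diagrams hσ (hle p), fun p q => ⟨fun hpq => ?_, fun hpq => ?_⟩⟩
  · exact patLE2_constRun hσ (hle p) (WithBot.coe_le_coe.2 (WithBot.coe_le_coe.2 hpq))
  · exact WithBot.coe_le_coe.1 (WithBot.coe_le_coe.1 (le_of_patLE2_constRun hσ (hle q) hpq))
end
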